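/- arXiv:2402.15689 — 4 statements merged into one kernel-verified Lean document; each statement's English description precedes it below -/
import Mathlib

section
/- Let f(z) = Σ_{n=0}^∞ a_n z^n belong to the class B and let λ = (221 − 43√17)/64. Then for every z in the unit disk with |z| = r ≤ (√17 − 3)/4, one has |f(z)| + |f′(z)| r + B₂(f,r) + A(f₀,r) + λ·(S_r/π) ≤ 1, where S_r/π = Σ_{n=1}^∞ n |a_n|² r^{2n}. Moreover, neither the radius (√17 − 3)/4 nor the constant λ = (221 − 43√17)/64 can be improved: for any λ′ > λ there exists f ∈ B (of the form f*_a(z) = (a+z)/(1+az) with a close to 1) for which the corresponding sum at r = (√17 − 3)/4 exceeds 1. -/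
/-- Membership in the class `B` of analytic self-maps of the unit disk,
together with its Taylor coefficient sequence `a`. -/
def InClassB (f : ℂ → ℂ) (a : ℕ → ℂ) : Prop :=
  (∀ z : ℂ, ‖z‖ < 1 → HasSum (fun n => a n * z ^ n) (f z)) ∧
  (∀ z : ℂ, ‖z‖ < 1 → ‖f z‖ ≤ 1)

/-- `S_r/π = Σ_{n=1}^∞ n |a_n|² r^{2n}`. -/
noncomputable def SrOverPi (a : ℕ → ℂ) (r : ℝ) : ℝ :=
  ∑' n : ℕ, ((n : ℝ) + 1) * ‖a (n + 1)‖ ^ 2 * r ^ (2 * (n + 1))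

/-- The quantity `𝒢_{1,f}(r) = |f(z)| + |f′(z)|r + B₂(f,r) + A(f₀,r) + λ (S_r/π)`. -/
noncomputable def Gexpr1 (f : ℂ → ℂ) (a : ℕ → ℂ) (z : ℂ) (r lam : ℝ) : ℝ :=
  ‖f z‖ + ‖deriv f z‖ * r + (∑' n : ℕ, ‖a (n + 2)‖ * r ^ (n + 2))
    + (1 / (1 + ‖a 0‖) + r / (1 - r)) * (∑' n : ℕ, ‖a (n + 1)‖ ^ 2 * r ^ (2 * (n + 1)))
    + lam * SrOverPi a r

open MeasureTheory AddCircle Finset in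
theorem sum_sq_norm_le_of_norm_tsum_le_on_circle {c g : ℕ → ℂ} (hc : Summable fun n => ‖c n‖) {M : ℕ}
    (hle : ∀ w : ℂ, ‖w‖ = 1 → ‖∑' n, c n * w ^ n‖ ≤ ‖∑ j ∈ range M, g j * w ^ j‖) (K : ℕ) :
    ∑ k ∈ range K, ‖c k‖ ^ 2 ≤ ∑ j ∈ range M, ‖g j‖ ^ 2 := by
  have : Fact (0 < (1 : ℝ)) := ⟨one_pos⟩
  let v : ℕ → Lp ℂ 2 (@haarAddCircle (1 : ℝ) _) := fun n => fourierLp 2 (n : ℤ)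
  have hv : Orthonormal ℂ v := orthonormal_fourier.comp _ Nat.cast_injective
  let F : ℕ → C(AddCircle (1 : ℝ), ℂ) := fun n => c n • fourier (n : ℤ)
  have hF : Summable F := by
    refine Summable.of_norm ?_
    simpa [F, norm_smul, fourier_norm] using hc
  let G : C(AddCircle (1 : ℝ), ℂ) := ∑ j ∈ range M, g j • fourier (j : ℤ)
  let L := ContinuousMap.toLp (E := ℂ) 2 (@haarAddCircle (1 : ℝ) _) ℂ
  have hLF : HasSum (fun n => c n • v n) (L (∑' n, F n)) := by
    have := hF.hasSum.mapL L
    simpa [F, L, v, fourierLp] using this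
  have hLG : L G = ∑ j ∈ range M, g j • v j := by simp [G, L, v, fourierLp]
  have h1 : ∀ k, inner ℂ (v k) (L (∑' n, F n)) = c k := fun k => by
    have h2 := hLF.mapL (innerSL ℂ (v k))
    refine h2.unique ?_
    have h3 : (fun n => innerSL ℂ (v k) (c n • v n)) = fun n => if n = k then c k else 0 := by
      funext n
      have := (orthonormal_iff_ite.1 hv) k n
      simp only [map_smul, innerSL_apply_apply, this, smul_eq_mul]
      by_cases h : k = n
      · subst h; simp
      · simp [h, Ne.symm h]
    rw [h3]
    exact hasSum_ite_eq k (c k)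
  have hval : ∀ (n : ℕ) (t : AddCircle (1 : ℝ)), fourier (n : ℤ) t = (toCircle t : ℂ) ^ n := by
    intro n t
    simp [toCircle_nsmul]
  have hnorm : ‖L (∑' n, F n)‖ ≤ ‖L G‖ := by
    refine Lp.norm_le_norm_of_ae_le ?_
    filter_upwards [ContinuousMap.coeFn_toLp (p := 2) (𝕜 := ℂ) (@haarAddCircle (1 : ℝ) _) (∑' n, F n),
      ContinuousMap.coeFn_toLp (p := 2) (𝕜 := ℂ) (@haarAddCircle (1 : ℝ) _) G] with t h3 h4
    rw [h3, h4]
    have := hle (toCircle t : ℂ) (Circle.norm_coe _)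
    have h5 : (∑' n, F n) t = ∑' n, c n * (toCircle t : ℂ) ^ n := by
      rw [← ContinuousMap.tsum_apply hF]
      simp only [F, ContinuousMap.smul_apply, hval, smul_eq_mul]
    have h6 : G t = ∑ j ∈ range M, g j * (toCircle t : ℂ) ^ j := by
      simp only [G, ContinuousMap.sum_apply, ContinuousMap.smul_apply, hval, smul_eq_mul]
    rwa [h5, h6]
  have hG : ‖L G‖ ^ 2 = ∑ j ∈ range M, ‖g j‖ ^ 2 := by
    have := hv.inner_sum g g (range M)
    rw [← hLG, inner_self_eq_norm_sq_to_K] at this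
    simp only [← Complex.normSq_eq_conj_mul_self, Complex.normSq_eq_norm_sq] at this
    exact Complex.ofReal_injective (by simpa using this)
  calc ∑ k ∈ range K, ‖c k‖ ^ 2 = ∑ k ∈ range K, ‖inner ℂ (v k) (L (∑' n, F n))‖ ^ 2 := by simp [h1]
    _ ≤ ‖L (∑' n, F n)‖ ^ 2 := hv.sum_inner_products_le _
    _ ≤ ‖L G‖ ^ 2 := by gcongr
    _ = _ := hG

open Finset Filter Topology in
theorem sum_sq_norm_le_of_norm_le_on_disk {b g : ℕ → ℂ} {h : ℂ → ℂ}
    (hb : ∀ z : ℂ, ‖z‖ < 1 → HasSum (fun n => b n * z ^ n) (h z)) {M : ℕ}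
    (hle : ∀ z : ℂ, ‖z‖ < 1 → ‖h z‖ ≤ ‖∑ j ∈ range M, g j * z ^ j‖) (K : ℕ) :
    ∑ k ∈ range K, ‖b k‖ ^ 2 ≤ ∑ j ∈ range M, ‖g j‖ ^ 2 := by
  have key : ∀ r : ℝ, 0 ≤ r → r < 1 →
      ∑ k ∈ range K, ‖b k * r ^ k‖ ^ 2 ≤ ∑ j ∈ range M, ‖g j * r ^ j‖ ^ 2 := by
    intro r hr0 hr1
    have hw : ∀ w : ℂ, ‖w‖ = 1 → ‖(r : ℂ) * w‖ < 1 := fun w hw => by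
      simpa [hw, abs_of_nonneg hr0] using hr1
    refine sum_sq_norm_le_of_norm_tsum_le_on_circle (c := fun k => b k * (r : ℂ) ^ k)
      (g := fun k => g k * (r : ℂ) ^ k) ?_ ?_ K
    · simpa using (hb _ (hw 1 (by simp))).summable.norm
    · intro w h1
      have h2 := hle _ (hw w h1)
      rw [← (hb _ (hw w h1)).tsum_eq] at h2
      simpa [mul_pow, mul_assoc] using h2
  have lim : ∀ (u : ℕ → ℂ) (N : ℕ), Tendsto (fun r : ℝ => ∑ k ∈ range N, ‖u k * (r : ℂ) ^ k‖ ^ 2)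
      (𝓝[<] 1) (𝓝 (∑ k ∈ range N, ‖u k‖ ^ 2)) := by
    intro u N
    have : Continuous (fun r : ℝ => ∑ k ∈ range N, ‖u k * (r : ℂ) ^ k‖ ^ 2) := by fun_prop
    simpa using (this.tendsto 1).mono_left nhdsWithin_le_nhds
  refine le_of_tendsto_of_tendsto (lim b K) (lim g M) ?_
  filter_upwards [Ioo_mem_nhdsLT (zero_lt_one' ℝ)] with r hr using key r hr.1.le hr.2

namespace InClassB

variable {f : ℂ → ℂ} {a : ℕ → ℂ}

open Finset in
theorem sum_sq_norm_convolution_le (hf : InClassB f a) (g : ℕ → ℂ) {M : ℕ} (hg : ∀ j, M ≤ j → g j = 0)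
    (K : ℕ) :
    ∑ k ∈ range K, ‖∑ j ∈ range (k + 1), g j * a (k - j)‖ ^ 2 ≤ ∑ j ∈ range M, ‖g j‖ ^ 2 := by
  refine sum_sq_norm_le_of_norm_le_on_disk (h := fun z => (∑ j ∈ range M, g j * z ^ j) * f z) ?_ ?_ K
  · intro z hz
    have hgz : HasSum (fun j => g j * z ^ j) (∑ j ∈ range M, g j * z ^ j) :=
      hasSum_sum_of_ne_finset_zero fun j hj => by simp [hg j (by simpa using hj)]
    have := hasSum_sum_range_mul_of_summable_norm hgz.summable.norm (hf.1 z hz).summable.norm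
    rw [hgz.tsum_eq, (hf.1 z hz).tsum_eq] at this
    refine this.congr_fun fun k => ?_
    rw [sum_mul]
    refine sum_congr rfl fun j hj => ?_
    have : z ^ k = z ^ j * z ^ (k - j) := by
      rw [← pow_add, Nat.add_sub_cancel' (by simpa [Nat.lt_succ_iff] using hj)]
    rw [this]; ring
  · intro z hz
    rw [norm_mul]
    exact mul_le_of_le_one_right (norm_nonneg _) (hf.2 z hz)

open Finset in
theorem sum_sq_norm_le_one (hf : InClassB f a) (K : ℕ) : ∑ k ∈ range K, ‖a k‖ ^ 2 ≤ 1 := by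
  have := hf.sum_sq_norm_convolution_le (fun j => if j = 0 then 1 else 0) (M := 1)
    (fun j hj => by simp; omega) K
  simpa using this

theorem sq_le_mul_of_forall {x d s : ℝ} (hs0 : 0 ≤ s) (hs : s ≤ 1)
    (h : ∀ t : ℝ, x ^ 2 * (1 + t * s) ^ 2 ≤ d + (t * x) ^ 2 * s) : x ^ 2 ≤ d * (1 - s) := by
  rcases hs.lt_or_eq with hs | rfl
  · have h1 : 0 < 1 - s := by linarith
    have := h (1 / (1 - s))
    have h2 : x ^ 2 * (1 + 1 / (1 - s) * s) ^ 2 - (1 / (1 - s) * x) ^ 2 * s = x ^ 2 / (1 - s) := by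
      field_simp; ring
    rw [← div_le_iff₀ h1]; linarith
  · by_contra! hx
    have hx : 0 < x ^ 2 := by linarith
    have := h (d / x ^ 2)
    have h2 : x ^ 2 * (1 + d / x ^ 2 * 1) ^ 2 - (d / x ^ 2 * x) ^ 2 * 1 = x ^ 2 + 2 * d := by
      have h3 : d / x ^ 2 * x ^ 2 = d := div_mul_cancel₀ d hx.ne'
      linear_combination 2 * h3
    have := h 0
    nlinarith

open Finset ComplexConjugate in
theorem sq_norm_sum_le (hf : InClassB f a) (p : ℕ → ℂ) (m N : ℕ) (hN : 1 ≤ N) :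
    ‖∑ j ∈ range m, p j * a (m + N - 1 - j)‖ ^ 2 ≤
      (∑ j ∈ range m, ‖p j‖ ^ 2 - ∑ k ∈ range m, ‖∑ j ∈ range (k + 1), p j * a (k - j)‖ ^ 2) *
        (1 - ∑ j ∈ range N, ‖a j‖ ^ 2) := by
  set X := ∑ j ∈ range m, p j * a (m + N - 1 - j) with hX
  set s := ∑ j ∈ range N, ‖a j‖ ^ 2 with hs
  have hs0 : 0 ≤ s := by positivity
  have hs1 : s ≤ 1 := hf.sum_sq_norm_le_one N
  clear_value X s
  refine sq_le_mul_of_forall hs0 hs1 fun t => ?_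
  let g : ℕ → ℂ := fun j => if j < m then p j else
    if j < m + N then t * X * conj (a (N - 1 - (j - m))) else 0
  have h := hf.sum_sq_norm_convolution_le g (M := m + N)
    (fun j hj => by simp only [g]; rw [if_neg (by omega), if_neg (by omega)]) (m + N)
  have hg1 : ∀ j ∈ range m, g j = p j := fun j hj => if_pos (by simpa using hj)
  have hg2 : ∀ i ∈ range N, g (m + i) = t * X * conj (a (N - 1 - i)) := fun i hi => by
    simp only [g]; rw [if_neg (by omega), if_pos (by simpa using hi)]; simp
  have hsC : (s : ℂ) = ∑ i ∈ range N, conj (a (N - 1 - i)) * a (N - 1 - i) := by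
    rw [sum_range_reflect (fun i => conj (a i) * a i) N, hs]
    push_cast
    exact sum_congr rfl fun i _ => by
      rw [← Complex.normSq_eq_conj_mul_self, Complex.normSq_eq_norm_sq]; push_cast; rfl
  have hR : ∑ j ∈ range (m + N), ‖g j‖ ^ 2 = ∑ j ∈ range m, ‖p j‖ ^ 2 + (t * ‖X‖) ^ 2 * s := by
    rw [sum_range_add, sum_congr rfl (fun j hj => by rw [hg1 j hj])]
    congr 1
    rw [hs, ← sum_range_reflect (fun i => ‖a i‖ ^ 2) N, mul_sum]
    refine sum_congr rfl fun i hi => ?_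
    rw [hg2 i hi]
    simp [mul_pow]
  have htop : ∑ j ∈ range (m + N), g j * a (m + N - 1 - j) = X * (1 + t * s : ℝ) := by
    rw [sum_range_add, sum_congr rfl (fun j hj => by rw [hg1 j hj]), ← hX]
    push_cast
    rw [hsC, mul_add, mul_one, mul_sum, mul_sum]
    congr 1
    refine sum_congr rfl fun i hi => ?_
    rw [hg2 i hi, show m + N - 1 - (m + i) = N - 1 - i by omega]; ring
  have hL : ∑ k ∈ range m, ‖∑ j ∈ range (k + 1), p j * a (k - j)‖ ^ 2 + ‖X‖ ^ 2 * (1 + t * s) ^ 2 ≤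
      ∑ k ∈ range (m + N), ‖∑ j ∈ range (k + 1), g j * a (k - j)‖ ^ 2 := by
    obtain ⟨N', rfl⟩ : ∃ N', N = N' + 1 := ⟨N - 1, by omega⟩
    rw [← add_assoc, sum_range_succ]
    rw [← add_assoc] at htop
    simp only [Nat.add_sub_cancel] at htop
    rw [htop, norm_mul, mul_pow, Complex.norm_real, Real.norm_eq_abs, sq_abs]
    gcongr
    refine le_trans (le_of_eq ?_) (sum_le_sum_of_subset_of_nonneg
      (range_subset_range.2 (Nat.le_add_right m N')) fun _ _ _ => by positivity)
    refine sum_congr rfl fun k hk => ?_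
    congr 2
    refine sum_congr rfl fun j hj => ?_
    rw [hg1 j (by simp at hk hj ⊢; omega)]
  linarith

open Finset in
theorem norm_coeff_odd_le (hf : InClassB f a) (n : ℕ) :
    ‖a (2 * n + 1)‖ ≤ 1 - ∑ k ∈ range (n + 1), ‖a k‖ ^ 2 := by
  have h := hf.sq_norm_sum_le (fun j => if j = 0 then 1 else 0) (n + 1) (n + 1) (by omega)
  have h1 := hf.sum_sq_norm_le_one (n + 1)
  refine abs_le_of_sq_le_sq' ?_ (by linarith) |>.2
  rw [show n + 1 + (n + 1) - 1 = 2 * n + 1 by omega] at h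
  simpa [sq, apply_ite] using h

open Finset ComplexConjugate in
theorem norm_coeff_even_le (hf : InClassB f a) (n : ℕ) (hn : 1 ≤ n) :
    ‖a (2 * n)‖ ≤ 1 - ∑ k ∈ range n, ‖a k‖ ^ 2 - ‖a n‖ ^ 2 / (1 + ‖a 0‖) := by
  obtain ⟨μ, hμ, hμ'⟩ : ∃ μ : ℂ, ‖μ‖ = ‖a n‖ / (1 + ‖a 0‖) ∧
      ‖a (2 * n) + μ * a n‖ = ‖a (2 * n)‖ + ‖a n‖ ^ 2 / (1 + ‖a 0‖) := by
    by_cases hz : a n = 0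
    · exact ⟨0, by simp [hz]⟩
    have hz' : (‖a n‖ : ℂ) ≠ 0 := by simpa using hz
    have hq : (0 : ℝ) < 1 + ‖a 0‖ := by positivity
    obtain ⟨u, hu, hua⟩ : ∃ u : ℂ, ‖u‖ = 1 ∧ a (2 * n) = ‖a (2 * n)‖ * u := by
      by_cases hy : a (2 * n) = 0
      · exact ⟨1, by simp [hy]⟩
      · have hy' : (‖a (2 * n)‖ : ℂ) ≠ 0 := by simpa using hy
        exact ⟨a (2 * n) / ‖a (2 * n)‖, by simp [hy], by field_simp⟩
    refine ⟨((1 / (1 + ‖a 0‖) : ℝ) : ℂ) * (u * conj (a n)), ?_, ?_⟩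
    · rw [norm_mul, norm_mul, hu, Complex.norm_real, Real.norm_of_nonneg (by positivity),
        RCLike.norm_conj]
      ring
    · have h1 : ((1 / (1 + ‖a 0‖) : ℝ) : ℂ) * (u * conj (a n)) * a n =
          ((‖a n‖ ^ 2 / (1 + ‖a 0‖) : ℝ) : ℂ) * u := by
        rw [mul_assoc, mul_assoc, ← Complex.normSq_eq_conj_mul_self, Complex.normSq_eq_norm_sq]
        push_cast; ring
      rw [h1]
      nth_rw 1 [hua]
      rw [← add_mul, norm_mul, hu, mul_one, ← Complex.ofReal_add, Complex.norm_real,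
        Real.norm_of_nonneg (by positivity)]
  have h := hf.sq_norm_sum_le (fun j => if j = 0 then 1 else if j = n then μ else 0) (n + 1) n hn
  have h1 := hf.sum_sq_norm_le_one n
  have e1 : ∑ j ∈ range (n + 1), (if j = 0 then 1 else if j = n then μ else 0) * a (n + 1 + n - 1 - j)
      = a (2 * n) + μ * a n := by
    rw [sum_eq_add_of_mem 0 n (by simp) (by simp) (by omega)]
    · rw [if_pos rfl, if_neg (by omega), if_pos rfl, show n + 1 + n - 1 - 0 = 2 * n by omega,
        show n + 1 + n - 1 - n = n by omega, one_mul]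
    · intro c _ hc; simp [hc.1, hc.2]
  have e2 : ∑ j ∈ range (n + 1), ‖(if j = 0 then 1 else if j = n then μ else 0 : ℂ)‖ ^ 2 = 1 + ‖μ‖ ^ 2 := by
    rw [sum_eq_add_of_mem 0 n (by simp) (by simp) (by omega)]
    · rw [if_pos rfl, if_neg (by omega), if_pos rfl]; simp
    · intro c _ hc; simp [hc.1, hc.2]
  have e3 : ∑ k ∈ range (n + 1), ‖∑ j ∈ range (k + 1),
      (if j = 0 then 1 else if j = n then μ else 0) * a (k - j)‖ ^ 2 =
      ∑ k ∈ range n, ‖a k‖ ^ 2 + ‖a n + μ * a 0‖ ^ 2 := by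
    rw [sum_range_succ]
    congr 1
    · refine sum_congr rfl fun k hk => ?_
      congr 2
      rw [sum_eq_single_of_mem 0 (by simp)]
      · simp
      · intro j hj hj0
        simp at hk hj
        rw [if_neg hj0, if_neg (by omega), zero_mul]
    · congr 2
      rw [sum_eq_add_of_mem 0 n (by simp) (by simp) (by omega)]
      · rw [if_pos rfl, if_neg (by omega), if_pos rfl]; simp
      · intro c _ hc; simp [hc.1, hc.2]
  rw [e1, e2, e3, hμ'] at h
  set s := ∑ k ∈ range n, ‖a k‖ ^ 2
  have h0 : 0 < 1 + ‖a 0‖ := by positivity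
  have h2 : ‖μ‖ ≤ ‖a n + μ * a 0‖ := by
    have h3 : ‖a n‖ ≤ ‖a n + μ * a 0‖ + ‖μ * a 0‖ := by
      simpa using norm_sub_le (a n + μ * a 0) (μ * a 0)
    rw [norm_mul] at h3
    have : ‖μ‖ * (1 + ‖a 0‖) = ‖a n‖ := by rw [hμ]; field_simp
    nlinarith
  have h4 : ‖μ‖ ^ 2 ≤ ‖a n + μ * a 0‖ ^ 2 := by gcongr
  have h5 : (‖a (2 * n)‖ + ‖a n‖ ^ 2 / (1 + ‖a 0‖)) ^ 2 ≤ (1 - s) ^ 2 := by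
    refine h.trans ?_
    rw [sq (1 - s)]
    exact mul_le_mul_of_nonneg_right (by linarith) (by linarith)
  have := (abs_le_of_sq_le_sq' h5 (by linarith)).2
  linarith

theorem norm_coeff_le (hf : InClassB f a) (n : ℕ) (hn : 1 ≤ n) : ‖a n‖ ≤ 1 - ‖a 0‖ ^ 2 := by
  have h0 : ∀ m, 1 ≤ m → ‖a 0‖ ^ 2 ≤ ∑ k ∈ Finset.range m, ‖a k‖ ^ 2 := fun m hm =>
    Finset.single_le_sum (f := fun k => ‖a k‖ ^ 2) (fun _ _ => by positivity) (by simp; omega)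
  obtain ⟨m, rfl | rfl⟩ := Nat.even_or_odd' n
  · have := hf.norm_coeff_even_le m (by omega)
    have := h0 m (by omega)
    have : 0 ≤ ‖a m‖ ^ 2 / (1 + ‖a 0‖) := by positivity
    linarith
  · have := hf.norm_coeff_odd_le m
    have := h0 (m + 1) (by omega)
    linarith


theorem coeff_zero (hf : InClassB f a) : f 0 = a 0 := by
  have := (hf.1 0 (by simp)).unique (hasSum_single 0 fun n hn => by simp [hn])
  simpa using this

theorem norm_coeff_zero_le (hf : InClassB f a) : ‖a 0‖ ≤ 1 := by
  simpa [hf.coeff_zero] using hf.2 0 (by simp)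

theorem differentiableOn (hf : InClassB f a) : DifferentiableOn ℂ f (Metric.ball 0 1) := by
  have h : HasFPowerSeriesOnBall f (FormalMultilinearSeries.ofScalars ℂ a) 0 1 := by
    refine ⟨?_, one_pos, ?_⟩
    · refine ENNReal.le_of_forall_nnreal_lt fun r hr => ?_
      have hr : (r : ℝ) < 1 := by exact_mod_cast hr
      refine FormalMultilinearSeries.le_radius_of_summable _ ?_
      have := (hf.1 (r : ℂ) (by simpa using hr)).summable.norm
      simpa [FormalMultilinearSeries.ofScalars_norm] using this
    · intro y hy
      rw [← ENNReal.ofReal_one, Metric.eball_ofReal, mem_ball_zero_iff] at hy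
      simpa [FormalMultilinearSeries.ofScalars_apply_eq, mul_comm] using hf.1 y hy
  have := h.differentiableOn
  rwa [show (1 : ENNReal) = ENNReal.ofReal 1 by simp, Metric.eball_ofReal] at this

theorem of_differentiableOn {g : ℂ → ℂ} (hd : DifferentiableOn ℂ g (Metric.ball 0 1))
    (hg : ∀ z : ℂ, ‖z‖ < 1 → ‖g z‖ ≤ 1) :
    InClassB g (fun n => (n.factorial : ℂ)⁻¹ * iteratedDeriv n g 0) := by
  refine ⟨fun z hz => ?_, hg⟩
  refine (Complex.hasSum_taylorSeries_on_ball hd (by simpa using hz)).congr_fun fun n => ?_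
  simp only [smul_eq_mul, sub_zero]; ring

theorem norm_deriv_le (hf : InClassB f a) {z : ℂ} (hz : ‖z‖ < 1) :
    ‖deriv f z‖ * (1 - ‖z‖ ^ 2) ≤ 1 - ‖f z‖ ^ 2 := by
  let φ : ℂ → ℂ := fun w => (w + z) / (1 + (starRingEnd ℂ) z * w)
  have hne : ∀ w : ℂ, ‖w‖ < 1 → 1 + (starRingEnd ℂ) z * w ≠ 0 := fun w hw h => by
    have h1 : ‖(starRingEnd ℂ) z * w‖ = 1 := by
      rw [show (starRingEnd ℂ) z * w = -1 by linear_combination h]; simp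
    rw [norm_mul, RCLike.norm_conj] at h1
    nlinarith [norm_nonneg w, norm_nonneg z]
  have hφ : ∀ w : ℂ, ‖w‖ < 1 → ‖φ w‖ < 1 := fun w hw => by
    have h0 := hne w hw
    simp only [φ]
    rw [norm_div, div_lt_one (by simpa using h0), ← sq_lt_sq₀ (norm_nonneg _) (norm_nonneg _),
      ← Complex.normSq_eq_norm_sq, ← Complex.normSq_eq_norm_sq]
    have h1 : Complex.normSq w < 1 := by
      rw [Complex.normSq_eq_norm_sq]; nlinarith [norm_nonneg w]
    have h2 : Complex.normSq z < 1 := by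
      rw [Complex.normSq_eq_norm_sq]; nlinarith [norm_nonneg z]
    simp only [Complex.normSq_apply, Complex.add_re, Complex.add_im, Complex.mul_re, Complex.mul_im,
      Complex.conj_re, Complex.conj_im, Complex.one_re, Complex.one_im] at *
    nlinarith
  have hφd : ∀ w : ℂ, ‖w‖ < 1 → DifferentiableAt ℂ φ w := fun w hw => by
    have := hne w hw
    simp only [φ]
    fun_prop (disch := assumption)
  have hfd : ∀ w : ℂ, ‖w‖ < 1 → DifferentiableAt ℂ f w := fun w hw =>
    hf.differentiableOn.differentiableAt (Metric.isOpen_ball.mem_nhds (by simpa using hw))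
  have hg := of_differentiableOn (g := f ∘ φ)
    (fun w hw => by
      have hw : ‖w‖ < 1 := by simpa using hw
      exact ((hfd _ (hφ w hw)).comp w (hφd w hw)).differentiableWithinAt)
    (fun w hw => hf.2 _ (hφ w hw))
  have h := hg.norm_coeff_le 1 le_rfl
  have hφ0 : φ 0 = z := by simp [φ]
  have hφ' : HasDerivAt φ (1 - ‖z‖ ^ 2 : ℝ) 0 := by
    have h1 : HasDerivAt (fun w : ℂ => w + z) 1 0 := (hasDerivAt_id 0).add_const z
    have h2 : HasDerivAt (fun w : ℂ => 1 + (starRingEnd ℂ) z * w) ((starRingEnd ℂ) z * 1) 0 :=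
      ((hasDerivAt_id (0 : ℂ)).const_mul _).const_add 1
    refine (h1.div h2 (by simp)).congr_deriv ?_
    have h3 := Complex.mul_conj z
    rw [Complex.normSq_eq_norm_sq] at h3
    push_cast at h3 ⊢
    rw [← h3]
    ring
  have hd : deriv (f ∘ φ) 0 = deriv f z * (1 - ‖z‖ ^ 2 : ℝ) := by
    have h1 : HasDerivAt f (deriv f z) (φ 0) := by rw [hφ0]; exact (hfd z hz).hasDerivAt
    exact (h1.comp 0 hφ').deriv
  simp only [Nat.factorial, iteratedDeriv_one, hd, iteratedDeriv_zero, Function.comp, hφ0] at h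
  simp only [norm_mul, Complex.norm_real] at h
  rw [Real.norm_of_nonneg (by nlinarith [norm_nonneg z])] at h
  simpa using h

theorem norm_le (hf : InClassB f a) {z : ℂ} (hz : ‖z‖ < 1) :
    ‖f z‖ ≤ (‖a 0‖ + ‖z‖) / (1 + ‖a 0‖ * ‖z‖) := by
  rw [le_div_iff₀ (by positivity)]
  have hF := hf.2 z hz
  rcases hf.norm_coeff_zero_le.lt_or_eq with h0 | h0
  · have hne : ∀ w : ℂ, ‖w‖ < 1 → 1 - (starRingEnd ℂ) (a 0) * f w ≠ 0 := fun w hw h => by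
      have h1 : ‖(starRingEnd ℂ) (a 0) * f w‖ = 1 := by
        rw [show (starRingEnd ℂ) (a 0) * f w = 1 by linear_combination -h]; simp
      rw [norm_mul, RCLike.norm_conj] at h1
      nlinarith [norm_nonneg (a 0), norm_nonneg (f w), hf.2 w hw]
    have hid : ∀ w : ℂ, ‖1 - (starRingEnd ℂ) (a 0) * w‖ ^ 2 - ‖w - a 0‖ ^ 2 =
        (1 - ‖a 0‖ ^ 2) * (1 - ‖w‖ ^ 2) := fun w => by
      simp only [← Complex.normSq_eq_norm_sq, Complex.normSq_apply, Complex.sub_re, Complex.sub_im,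
        Complex.mul_re, Complex.mul_im, Complex.conj_re, Complex.conj_im, Complex.one_re,
        Complex.one_im]
      ring
    have hs := Complex.norm_le_norm_of_mapsTo_ball (R := 1) (z := z)
      (f := fun w => (f w - a 0) / (1 - (starRingEnd ℂ) (a 0) * f w)) ?_ ?_ ?_ hz
    · rw [norm_div, div_le_iff₀ (by simpa using hne z hz)] at hs
      have h1 := hid (f z)
      have h2 : 1 - ‖a 0‖ * ‖f z‖ ≤ ‖1 - (starRingEnd ℂ) (a 0) * f z‖ := by
        have := norm_sub_norm_le (1 : ℂ) ((starRingEnd ℂ) (a 0) * f z)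
        simpa using this
      have h3 : ‖f z - a 0‖ ^ 2 ≤ (‖z‖ * ‖1 - (starRingEnd ℂ) (a 0) * f z‖) ^ 2 := by gcongr
      have h4 : 0 ≤ 1 - ‖a 0‖ * ‖f z‖ := by nlinarith [norm_nonneg (a 0), norm_nonneg (f z)]
      have h5 : (1 - ‖a 0‖ * ‖f z‖) ^ 2 ≤ ‖1 - (starRingEnd ℂ) (a 0) * f z‖ ^ 2 := by gcongr
      have h6 : 0 ≤ 1 - ‖z‖ ^ 2 := by nlinarith [norm_nonneg z]
      have h7 := mul_le_mul_of_nonneg_left h5 h6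
      have h8 : (‖f z‖ - ‖a 0‖) ^ 2 ≤ (‖z‖ * (1 - ‖a 0‖ * ‖f z‖)) ^ 2 := by nlinarith
      have := (abs_le_of_sq_le_sq' h8 (by positivity)).2
      linarith
    · intro w hw
      have hw' : ‖w‖ < 1 := by simpa using hw
      have := hf.differentiableOn w hw
      have h1 := hne w hw'
      fun_prop (disch := assumption)
    · intro w hw
      have hw : ‖w‖ < 1 := by simpa using hw
      rw [mem_closedBall_zero_iff, norm_div]
      refine div_le_one_of_le₀ ?_ (norm_nonneg _)
      have h1 := hid (f w)
      have h2 := hf.2 w hw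
      have : 0 ≤ (1 - ‖a 0‖ ^ 2) * (1 - ‖f w‖ ^ 2) :=
        mul_nonneg (by nlinarith [norm_nonneg (a 0)]) (by nlinarith [norm_nonneg (f w)])
      exact (sq_le_sq₀ (norm_nonneg _) (norm_nonneg _)).1 (by linarith)
    · simp [hf.coeff_zero]
  · rw [h0]; nlinarith [norm_nonneg z]

open Finset in
theorem sum_add_sum_le (hf : InClassB f a) {r : ℝ} (hr0 : 0 ≤ r) (hr1 : r < 1) (K : ℕ) :
    ∑ n ∈ range (2 * K), ‖a (n + 2)‖ * r ^ (n + 2) + (1 / (1 + ‖a 0‖) + r / (1 - r)) *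
      ∑ n ∈ range K, ‖a (n + 1)‖ ^ 2 * r ^ (2 * (n + 1)) ≤
    (1 - ‖a 0‖ ^ 2) * (r ^ 2 / (1 - r)) -
      (1 - ∑ n ∈ range (K + 1), ‖a n‖ ^ 2) * (r ^ (2 * K + 2) / (1 - r)) := by
  have h1r : 0 < 1 - r := by linarith
  induction K with
  | zero => simp
  | succ K ih =>
    have he := hf.norm_coeff_even_le (K + 1) (by omega)
    have ho := hf.norm_coeff_odd_le (K + 1)
    rw [show 2 * (K + 1) = 2 * K + 1 + 1 by ring, sum_range_succ, sum_range_succ, sum_range_succ _ K,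
      sum_range_succ _ (K + 1)]
    rw [sum_range_succ _ (K + 1)] at ho
    set P := ∑ n ∈ range (K + 1), ‖a n‖ ^ 2
    have he' := mul_le_mul_of_nonneg_right he (pow_nonneg hr0 (2 * K + 2))
    have ho' := mul_le_mul_of_nonneg_right ho (pow_nonneg hr0 (2 * K + 3))
    rw [show 2 * (K + 1) = 2 * K + 2 by ring] at he'
    rw [show 2 * (K + 1) + 1 = 2 * K + 3 by ring] at ho'
    have e1 : (1 - (P + ‖a (K + 1)‖ ^ 2)) * (r ^ (2 * K + 1 + 1 + 2) / (1 - r)) =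
        (1 - P) * (r ^ (2 * K + 2) / (1 - r)) -
        ((1 - P - ‖a (K + 1)‖ ^ 2 / (1 + ‖a 0‖)) * r ^ (2 * K + 2) +
          (1 - (P + ‖a (K + 1)‖ ^ 2)) * r ^ (2 * K + 3) +
        (1 / (1 + ‖a 0‖) + r / (1 - r)) * (‖a (K + 1)‖ ^ 2 * r ^ (2 * K + 2))) := by
      have : 1 + ‖a 0‖ ≠ 0 := by positivity
      field_simp
      ring
    rw [e1, mul_add]
    have e2 : ‖a (2 * K + 1 + 2)‖ * r ^ (2 * K + 1 + 2) = ‖a (2 * K + 3)‖ * r ^ (2 * K + 3) := rfl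
    have e3 : r ^ (2 * (K + 1)) = r ^ (2 * K + 2) := rfl
    rw [e2, e3]
    linarith

theorem norm_coeff_le_one (hf : InClassB f a) (n : ℕ) : ‖a n‖ ≤ 1 := by
  rcases n.eq_zero_or_pos with rfl | hn
  · exact hf.norm_coeff_zero_le
  · linarith [hf.norm_coeff_le n hn, sq_nonneg ‖a 0‖]

theorem summable_norm_mul_pow (hf : InClassB f a) {r : ℝ} (hr0 : 0 ≤ r) (hr1 : r < 1) :
    Summable fun n => ‖a n‖ * r ^ n := by
  have := (hf.1 (r : ℂ) (by simpa [abs_of_nonneg hr0] using hr1)).summable.norm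
  simpa [abs_of_nonneg hr0] using this

theorem summable_sq_norm_mul_pow (hf : InClassB f a) {r : ℝ} (hr0 : 0 ≤ r) (hr1 : r < 1) :
    Summable fun n : ℕ => ‖a (n + 1)‖ ^ 2 * r ^ (2 * (n + 1)) := by
  have h1 : Summable fun n : ℕ => (r ^ 2) ^ (n + 1) :=
    (summable_nat_add_iff 1).2 (summable_geometric_of_lt_one (sq_nonneg r) (by nlinarith))
  refine Summable.of_nonneg_of_le (fun n => by positivity) (fun n => ?_) h1
  rw [pow_mul]
  exact mul_le_of_le_one_left (by positivity)
    (pow_le_one₀ (norm_nonneg _) (hf.norm_coeff_le_one _))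

open Finset Filter in
theorem tsum_add_tsum_le (hf : InClassB f a) {r : ℝ} (hr0 : 0 ≤ r) (hr1 : r < 1) :
    (∑' n, ‖a (n + 2)‖ * r ^ (n + 2)) + (1 / (1 + ‖a 0‖) + r / (1 - r)) *
      (∑' n : ℕ, ‖a (n + 1)‖ ^ 2 * r ^ (2 * (n + 1))) ≤
    (1 - ‖a 0‖ ^ 2) * (r ^ 2 / (1 - r)) := by
  have h1 := ((summable_nat_add_iff 2).2 (hf.summable_norm_mul_pow hr0 hr1)).hasSum.tendsto_sum_nat
  have h2 := (hf.summable_sq_norm_mul_pow hr0 hr1).hasSum.tendsto_sum_nat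
  have h3 : Tendsto (fun K : ℕ => 2 * K) atTop atTop :=
    tendsto_id.const_mul_atTop' (by norm_num)
  refine le_of_tendsto' ((h1.comp h3).add (h2.const_mul _)) fun K => ?_
  have h := hf.sum_add_sum_le hr0 hr1 K
  have h4 := hf.sum_sq_norm_le_one (K + 1)
  have h1r : 0 < 1 - r := by linarith
  have : 0 ≤ (1 - ∑ n ∈ range (K + 1), ‖a n‖ ^ 2) * (r ^ (2 * K + 2) / (1 - r)) :=
    mul_nonneg (by linarith) (by positivity)
  simp only [Function.comp]
  linarith

end InClassB

theorem hasSum_succ_mul_pow_two_mul {r : ℝ} (hr0 : 0 ≤ r) (hr1 : r < 1) :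
    HasSum (fun n : ℕ => ((n : ℝ) + 1) * r ^ (2 * (n + 1))) (r ^ 2 / (1 - r ^ 2) ^ 2) := by
  have h1 := hasSum_coe_mul_geometric_of_norm_lt_one (r := r ^ 2)
    (by rw [Real.norm_of_nonneg (by positivity)]; nlinarith)
  rw [← hasSum_nat_add_iff' 1] at h1
  simpa [pow_mul] using h1

theorem InClassB.srOverPi_le {f : ℂ → ℂ} {a : ℕ → ℂ} (hf : InClassB f a) {r : ℝ} (hr0 : 0 ≤ r)
    (hr1 : r < 1) : SrOverPi a r ≤ (1 - ‖a 0‖ ^ 2) ^ 2 * (r ^ 2 / (1 - r ^ 2) ^ 2) := by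
  have h := (hasSum_succ_mul_pow_two_mul hr0 hr1).mul_left ((1 - ‖a 0‖ ^ 2) ^ 2)
  have hle : ∀ n : ℕ, ((n : ℝ) + 1) * ‖a (n + 1)‖ ^ 2 * r ^ (2 * (n + 1)) ≤
      (1 - ‖a 0‖ ^ 2) ^ 2 * (((n : ℝ) + 1) * r ^ (2 * (n + 1))) := fun n => by
    have : ‖a (n + 1)‖ ^ 2 ≤ (1 - ‖a 0‖ ^ 2) ^ 2 := by
      gcongr; exact hf.norm_coeff_le _ (by omega)
    calc _ = ‖a (n + 1)‖ ^ 2 * (((n : ℝ) + 1) * r ^ (2 * (n + 1))) := by ring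
      _ ≤ _ := by gcongr
  rw [SrOverPi, ← h.tsum_eq]
  exact (Summable.of_nonneg_of_le (fun n => by positivity) hle h.summable).tsum_le_tsum hle h.summable

theorem mul_one_sub_sq_div_one_add_mul_sq_mono {r R α : ℝ} (hr : 0 ≤ r) (hrR : r ≤ R)
    (hR : R < 1) (h0 : 0 ≤ α) (h1 : α ≤ 1) :
    r * (1 - α ^ 2) / (1 + α * r) ^ 2 ≤ R * (1 - α ^ 2) / (1 + α * R) ^ 2 := by
  have hR0 : 0 ≤ R := hr.trans hrR
  rw [div_le_div_iff₀ (by positivity) (by positivity)]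
  have h2 : r * R ≤ 1 := by nlinarith
  have h3 : α ^ 2 ≤ 1 := by nlinarith
  have h4 : α ^ 2 * (r * R) ≤ 1 := mul_le_one₀ h3 (by positivity) h2
  have := mul_nonneg (sub_nonneg.2 h3) (mul_nonneg (sub_nonneg.2 hrR) (sub_nonneg.2 h4))
  linarith

theorem add_div_one_add_mul_mono {r R α : ℝ} (hr : 0 ≤ r) (hrR : r ≤ R) (h0 : 0 ≤ α)
    (h1 : α ≤ 1) : (α + r) / (1 + α * r) ≤ (α + R) / (1 + α * R) := by
  have hR0 : 0 ≤ R := hr.trans hrR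
  rw [div_le_div_iff₀ (by positivity) (by positivity)]
  nlinarith [mul_nonneg (sub_nonneg.2 hrR) (sub_nonneg.2 (show α ^ 2 ≤ 1 by nlinarith))]

theorem InClassB.norm_add_norm_deriv_mul_le {f : ℂ → ℂ} {a : ℕ → ℂ} (hf : InClassB f a) {z : ℂ}
    (hz : 2 * ‖z‖ ≤ 1 - ‖z‖ ^ 2) :
    ‖f z‖ + ‖deriv f z‖ * ‖z‖ ≤ (‖a 0‖ + ‖z‖) / (1 + ‖a 0‖ * ‖z‖) +
      ‖z‖ * (1 - ‖a 0‖ ^ 2) / (1 + ‖a 0‖ * ‖z‖) ^ 2 := by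
  have hz1 : ‖z‖ < 1 := by nlinarith [norm_nonneg z]
  have hd := hf.norm_deriv_le hz1
  have hF := hf.norm_le hz1
  have hF1 := hf.2 z hz1
  have ha := hf.norm_coeff_zero_le
  have hr := norm_nonneg z
  have hα := norm_nonneg (a 0)
  generalize ‖z‖ = r at *
  generalize ‖a 0‖ = α at *
  generalize ‖deriv f z‖ = d at *
  generalize ‖f z‖ = F at *
  have hp : 0 < 1 - r ^ 2 := by nlinarith
  have hq : 0 < 1 + α * r := by positivity
  have hG1 : (α + r) / (1 + α * r) ≤ 1 := by
    rw [div_le_one hq]; nlinarith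
  have e : r * (1 - α ^ 2) / (1 + α * r) ^ 2 =
      r * (1 - ((α + r) / (1 + α * r)) ^ 2) / (1 - r ^ 2) := by
    field_simp
    ring
  rw [e]
  generalize (α + r) / (1 + α * r) = G at *
  have h1 : d * r ≤ r * (1 - F ^ 2) / (1 - r ^ 2) := by
    rw [le_div_iff₀ hp]; nlinarith
  refine (add_le_add_right h1 F).trans ?_
  have h2 : G + r * (1 - G ^ 2) / (1 - r ^ 2) - (F + r * (1 - F ^ 2) / (1 - r ^ 2)) =
      (G - F) * (1 - r ^ 2 - r * (F + G)) / (1 - r ^ 2) := by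
    field_simp
    ring
  have h3 : 0 ≤ (G - F) * (1 - r ^ 2 - r * (F + G)) / (1 - r ^ 2) :=
    div_nonneg (mul_nonneg (by linarith) (by nlinarith)) hp.le
  linarith

theorem one_sub_majorant_eq {R : ℝ} (hR : 2 * R ^ 2 + 3 * R = 1) (hR0 : 0 < R) {α : ℝ}
    (hα : 0 ≤ α) :
    (α + R) / (1 + α * R) + R * (1 - α ^ 2) / (1 + α * R) ^ 2 +
      (1 - α ^ 2) * (R ^ 2 / (1 - R)) +
      (23 - 43 * R) / 16 * ((1 - α ^ 2) ^ 2 * (R ^ 2 / (1 - R ^ 2) ^ 2)) =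
    1 - (1 - α) ^ 3 * ((1 / 8 + R / 2) + (11 / 8 - 17 * R / 4) * α +
      (55 / 16 - 193 * R / 16) * α ^ 2 + (29 / 16 - 103 * R / 16) * α ^ 3) /
      (1 + α * R) ^ 2 := by
  have h1 : 1 - R ≠ 0 := by nlinarith
  have h2 : 1 - R ^ 2 ≠ 0 := by nlinarith
  have h3 : 1 + α * R ≠ 0 := by positivity
  have e1 : R ^ 2 / (1 - R) = (1 - 2 * R) / 4 := by
    rw [div_eq_div_iff h1 (by norm_num)]
    linear_combination hR
  have e2 : R ^ 2 / (1 - R ^ 2) ^ 2 = (11 - 18 * R) / 64 := by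
    rw [div_eq_div_iff (by positivity) (by norm_num)]
    linear_combination (9 * R ^ 3 - 19 * R ^ 2 + 15 * R + 11) * hR
  have e3 : (23 - 43 * R) * (11 - 18 * R) = 128 * (5 - 16 * R) := by
    linear_combination 387 * hR
  have e4 : (23 - 43 * R) / 16 * ((1 - α ^ 2) ^ 2 * ((11 - 18 * R) / 64)) =
      (1 - α ^ 2) ^ 2 * ((5 - 16 * R) / 8) := by
    linear_combination (1 - α ^ 2) ^ 2 / 1024 * e3
  have e5 : (1 - R) * (1 + α * R) - (1 + α) * (R + ((1 - 2 * R) / 4 +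
      (5 - 16 * R) / 8 * (1 - α ^ 2)) * (1 + α * R) ^ 2) =
      (1 - α) ^ 2 * ((1 / 8 + R / 2) + (11 / 8 - 17 * R / 4) * α +
        (55 / 16 - 193 * R / 16) * α ^ 2 + (29 / 16 - 103 * R / 16) * α ^ 3) := by
    linear_combination ((1 + α) * α ^ 2 * (5 / 2 - 2 * α ^ 2) / 2 * R -
      (1 - (1 + α) * (1 / 4 + 5 / 8 * (1 - α ^ 2)) -
        (1 - α) ^ 2 * (1 / 8 + 11 / 8 * α + 55 / 16 * α ^ 2 + 29 / 16 * α ^ 3))) * hR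
  rw [e1, e2, e4, show (1 - α) ^ 3 = (1 - α) * (1 - α) ^ 2 by ring, mul_assoc, ← e5]
  field_simp
  ring

theorem InClassB.gexpr_le_one {f : ℂ → ℂ} {a : ℕ → ℂ} (hf : InClassB f a) {R : ℝ}
    (hR : 2 * R ^ 2 + 3 * R = 1) {z : ℂ} (hz : ‖z‖ ≤ R) :
    Gexpr1 f a z ‖z‖ ((23 - 43 * R) / 16) ≤ 1 := by
  have hr := norm_nonneg z
  have hα := norm_nonneg (a 0)
  have hα1 := hf.norm_coeff_zero_le
  have hR0 : 0 < R := by nlinarith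
  have hR1 : R < 29 / 103 := by nlinarith
  have h1 := hf.norm_add_norm_deriv_mul_le (z := z) (by nlinarith)
  have h2 := hf.tsum_add_tsum_le hr (by linarith)
  have h3 := hf.srOverPi_le hr (by linarith)
  have h4 := add_div_one_add_mul_mono hr hz hα hα1
  have h5 := mul_one_sub_sq_div_one_add_mul_sq_mono hr hz (by linarith) hα hα1
  have hα2 : 0 ≤ 1 - ‖a 0‖ ^ 2 := by nlinarith
  have h1R : 0 < 1 - R := by linarith
  have h6 : (1 - ‖a 0‖ ^ 2) * (‖z‖ ^ 2 / (1 - ‖z‖)) ≤ (1 - ‖a 0‖ ^ 2) * (R ^ 2 / (1 - R)) := by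
    gcongr
  have h2R : 0 < 1 - R ^ 2 := by nlinarith
  have h7 : (1 - ‖a 0‖ ^ 2) ^ 2 * (‖z‖ ^ 2 / (1 - ‖z‖ ^ 2) ^ 2) ≤
      (1 - ‖a 0‖ ^ 2) ^ 2 * (R ^ 2 / (1 - R ^ 2) ^ 2) := by
    gcongr
  have hlam : 0 ≤ (23 - 43 * R) / 16 := by linarith
  have h8 := mul_le_mul_of_nonneg_left (h3.trans h7) hlam
  have h9 := one_sub_majorant_eq hR hR0 hα
  have h10 : 0 ≤ (1 - ‖a 0‖) ^ 3 * ((1 / 8 + R / 2) + (11 / 8 - 17 * R / 4) * ‖a 0‖ +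
      (55 / 16 - 193 * R / 16) * ‖a 0‖ ^ 2 + (29 / 16 - 103 * R / 16) * ‖a 0‖ ^ 3) /
      (1 + ‖a 0‖ * R) ^ 2 := by
    have : 0 ≤ 11 / 8 - 17 * R / 4 := by linarith
    have : 0 ≤ 55 / 16 - 193 * R / 16 := by linarith
    have : 0 ≤ 29 / 16 - 103 * R / 16 := by linarith
    have : 0 ≤ 1 - ‖a 0‖ := by linarith
    positivity
  unfold Gexpr1
  linarith

/-- The Taylor coefficients of `z ↦ (t + z) / (1 + t z)`. -/
noncomputable def diskAutCoeff (t : ℝ) : ℕ → ℂ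
  | 0 => t
  | n + 1 => (1 - t ^ 2) * (-t) ^ n

theorem one_add_mul_ne_zero_of_norm_lt_one {t : ℝ} (h0 : 0 ≤ t) (h1 : t < 1) {z : ℂ} (hz : ‖z‖ < 1) :
    1 + t * z ≠ 0 := fun h => by
  have h2 : ‖(t : ℂ) * z‖ = 1 := by
    rw [show (t : ℂ) * z = -1 by linear_combination h]; simp
  rw [norm_mul, Complex.norm_real, Real.norm_of_nonneg h0] at h2
  nlinarith [norm_nonneg z]

theorem inClassB_diskAut {t : ℝ} (h0 : 0 ≤ t) (h1 : t < 1) :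
    InClassB (fun z => (t + z) / (1 + t * z)) (diskAutCoeff t) := by
  refine ⟨fun z hz => ?_, fun z hz => ?_⟩
  · have hne := one_add_mul_ne_zero_of_norm_lt_one h0 h1 hz
    rw [← hasSum_nat_add_iff' 1]
    have hg := (hasSum_geometric_of_norm_lt_one (ξ := -(t * z)) (by
      rw [norm_neg, norm_mul, Complex.norm_real, Real.norm_of_nonneg h0]
      nlinarith [norm_nonneg z])).mul_left ((1 - t ^ 2) * z)
    have e : (t + z) / (1 + t * z) - ∑ n ∈ Finset.range 1, diskAutCoeff t n * z ^ n =
        (1 - t ^ 2) * z * (1 - -(t * z))⁻¹ := by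
      have : 1 - -(t * z) ≠ 0 := by simpa using hne
      simp only [Finset.sum_range_one, diskAutCoeff]
      field_simp
      ring
    rw [e]
    refine hg.congr_fun fun n => ?_
    simp only [diskAutCoeff]
    rw [← neg_mul, mul_pow]
    ring
  · have hne := one_add_mul_ne_zero_of_norm_lt_one h0 h1 hz
    rw [norm_div]
    refine div_le_one_of_le₀ ?_ (norm_nonneg _)
    rw [← sq_le_sq₀ (norm_nonneg _) (norm_nonneg _), ← Complex.normSq_eq_norm_sq,
      ← Complex.normSq_eq_norm_sq]
    have hz2 : Complex.normSq z < 1 := by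
      rw [Complex.normSq_eq_norm_sq]; nlinarith [norm_nonneg z]
    have ht2 : 0 ≤ 1 - t ^ 2 := by nlinarith
    have := mul_nonneg ht2 (sub_nonneg.2 hz2.le)
    simp only [Complex.normSq_apply, Complex.add_re, Complex.add_im, Complex.mul_re, Complex.mul_im,
      Complex.ofReal_re, Complex.ofReal_im, Complex.one_re, Complex.one_im] at *
    linarith

theorem norm_diskAutCoeff_succ {t : ℝ} (h0 : 0 ≤ t) (h1 : t < 1) (n : ℕ) :
    ‖diskAutCoeff t (n + 1)‖ = (1 - t ^ 2) * t ^ n := by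
  have : (0 : ℝ) ≤ 1 - t ^ 2 := by nlinarith
  have e : (1 - (t : ℂ) ^ 2) = ((1 - t ^ 2 : ℝ) : ℂ) := by push_cast; rfl
  rw [diskAutCoeff, e, norm_mul, norm_pow, norm_neg, Complex.norm_real, Complex.norm_real,
    Real.norm_of_nonneg h0, Real.norm_of_nonneg this]

theorem gexpr_diskAut {t r : ℝ} (h0 : 0 ≤ t) (h1 : t < 1) (hr0 : 0 ≤ r) (hr1 : r < 1) (lam : ℝ) :
    Gexpr1 (fun z => (t + z) / (1 + t * z)) (diskAutCoeff t) r r lam =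
      (t + r) / (1 + t * r) + r * (1 - t ^ 2) / (1 + t * r) ^ 2 +
      (1 - t ^ 2) * (r ^ 2 / (1 - r)) +
      lam * ((1 - t ^ 2) ^ 2 * (r ^ 2 / (1 - (t * r) ^ 2) ^ 2)) := by
  have htr0 : 0 ≤ t * r := by positivity
  have htr : t * r < 1 := by nlinarith
  have ht2 : 0 ≤ 1 - t ^ 2 := by nlinarith
  have hF : ‖((t : ℂ) + r) / (1 + t * r)‖ = (t + r) / (1 + t * r) := by
    have : ((t : ℂ) + r) / (1 + t * r) = (((t + r) / (1 + t * r) : ℝ) : ℂ) := by push_cast; rfl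
    rw [this, Complex.norm_real, Real.norm_of_nonneg (by positivity)]
  have hD : ‖deriv (fun z : ℂ => (t + z) / (1 + t * z)) r‖ = (1 - t ^ 2) / (1 + t * r) ^ 2 := by
    have hne := one_add_mul_ne_zero_of_norm_lt_one h0 h1 (z := r)
      (by rwa [Complex.norm_real, Real.norm_of_nonneg hr0])
    have d1 : HasDerivAt (fun w : ℂ => t + w) 1 r := (hasDerivAt_id (r : ℂ)).const_add (t : ℂ)
    have d2 : HasDerivAt (fun w : ℂ => 1 + t * w) (t * 1) r :=
      ((hasDerivAt_id (r : ℂ)).const_mul (t : ℂ)).const_add 1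
    have d3 := (d1.div d2 hne).deriv
    have e : (1 * (1 + (t : ℂ) * r) - (t + r) * (t * 1)) / (1 + t * r) ^ 2 =
        (((1 - t ^ 2) / (1 + t * r) ^ 2 : ℝ) : ℂ) := by
      push_cast; ring
    rw [e] at d3
    have d4 : deriv (fun z : ℂ => (t + z) / (1 + t * z)) r =
      (((1 - t ^ 2) / (1 + t * r) ^ 2 : ℝ) : ℂ) := d3
    rw [d4, Complex.norm_real, Real.norm_of_nonneg (by positivity)]
  have hB : ∑' n : ℕ, ‖diskAutCoeff t (n + 2)‖ * r ^ (n + 2) =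
      (1 - t ^ 2) * t * r ^ 2 * (1 - t * r)⁻¹ := by
    rw [← ((hasSum_geometric_of_lt_one htr0 htr).mul_left ((1 - t ^ 2) * t * r ^ 2)).tsum_eq]
    refine tsum_congr fun n => ?_
    rw [norm_diskAutCoeff_succ h0 h1]
    ring
  have hA : ∑' n : ℕ, ‖diskAutCoeff t (n + 1)‖ ^ 2 * r ^ (2 * (n + 1)) =
      (1 - t ^ 2) ^ 2 * r ^ 2 * (1 - (t * r) ^ 2)⁻¹ := by
    rw [← ((hasSum_geometric_of_lt_one (sq_nonneg (t * r)) (by nlinarith)).mul_left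
      ((1 - t ^ 2) ^ 2 * r ^ 2)).tsum_eq]
    refine tsum_congr fun n => ?_
    rw [norm_diskAutCoeff_succ h0 h1]
    ring
  have hS : SrOverPi (diskAutCoeff t) r =
      (1 - t ^ 2) ^ 2 * (r ^ 2 / (1 - (t * r) ^ 2) ^ 2) := by
    have h := (hasSum_choose_mul_geometric_of_norm_lt_one (𝕜 := ℝ) 1 (r := (t * r) ^ 2) (by
      rw [Real.norm_of_nonneg (sq_nonneg _)]; nlinarith)).mul_left ((1 - t ^ 2) ^ 2 * r ^ 2)
    rw [show (1 - t ^ 2) ^ 2 * (r ^ 2 / (1 - (t * r) ^ 2) ^ 2) =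
      (1 - t ^ 2) ^ 2 * r ^ 2 * (1 / (1 - (t * r) ^ 2) ^ (1 + 1)) by ring, ← h.tsum_eq, SrOverPi]
    refine tsum_congr fun n => ?_
    rw [norm_diskAutCoeff_succ h0 h1, Nat.choose_one_right]
    push_cast
    ring
  have hn : ‖diskAutCoeff t 0‖ = t := by
    rw [diskAutCoeff, Complex.norm_real, Real.norm_of_nonneg h0]
  simp only [Gexpr1, hF, hD, hB, hA, hS, hn]
  have k1 : 1 - t * r ≠ 0 := by linarith
  have k2 : 1 - (t * r) ^ 2 = (1 - t * r) * (1 + t * r) := by ring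
  have k3 : 1 + t * r ≠ 0 := by positivity
  have k4 : 1 - r ≠ 0 := by linarith
  have k5 : 1 + t ≠ 0 := by positivity
  have key : (1 - t ^ 2) * t * r ^ 2 * (1 - t * r)⁻¹ +
      (1 / (1 + t) + r / (1 - r)) * ((1 - t ^ 2) ^ 2 * r ^ 2 * (1 - (t * r) ^ 2)⁻¹) =
      (1 - t ^ 2) * (r ^ 2 / (1 - r)) := by
    rw [k2]
    field_simp
    ring
  rw [← key]
  ring

open Filter Topology in
theorem exists_one_lt_gexpr_diskAut {R : ℝ} (hR : 2 * R ^ 2 + 3 * R = 1) (hR0 : 0 < R) {lam : ℝ}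
    (hlam : (23 - 43 * R) / 16 < lam) :
    ∃ t : ℝ, 0 ≤ t ∧ t < 1 ∧
      1 < Gexpr1 (fun z => (t + z) / (1 + t * z)) (diskAutCoeff t) R R lam := by
  have hR1 : R < 1 := by nlinarith
  have hR2 : 0 < 1 - R ^ 2 := by nlinarith
  let ψ : ℝ → ℝ := fun t => (1 + t) ^ 2 * R ^ 2 *
    (lam / (1 - (t * R) ^ 2) ^ 2 - (23 - 43 * R) / 16 / (1 - R ^ 2) ^ 2) -
    (1 - t) * ((1 / 8 + R / 2) + (11 / 8 - 17 * R / 4) * t +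
      (55 / 16 - 193 * R / 16) * t ^ 2 + (29 / 16 - 103 * R / 16) * t ^ 3) / (1 + t * R) ^ 2
  have hψ : ContinuousAt ψ 1 := by
    have k1 : (1 - (1 * R) ^ 2) ^ 2 ≠ 0 := by rw [one_mul]; positivity
    have k2 : (1 + 1 * R) ^ 2 ≠ 0 := by positivity
    simp only [ψ]
    fun_prop (disch := assumption)
  have hψ1 : 0 < ψ 1 := by
    have : (23 - 43 * R) / 16 / (1 - R ^ 2) ^ 2 < lam / (1 - R ^ 2) ^ 2 := by gcongr
    have h2 : 0 < lam / (1 - R ^ 2) ^ 2 - (23 - 43 * R) / 16 / (1 - R ^ 2) ^ 2 := by linarith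
    simp only [ψ, one_mul, sub_self, zero_mul, zero_div, sub_zero]
    positivity
  have hev := (hψ.eventually (lt_mem_nhds hψ1)).filter_mono (nhdsWithin_le_nhds (s := Set.Iio 1))
  obtain ⟨t, ht, ht0, ht1⟩ := (hev.and (Ioo_mem_nhdsLT (show (0 : ℝ) < 1 by norm_num))).exists
  refine ⟨t, ht0.le, ht1, ?_⟩
  have h := one_sub_majorant_eq hR hR0 ht0.le
  rw [gexpr_diskAut ht0.le ht1 hR0.le hR1]
  have hpos : 0 < (1 - t) ^ 2 * ψ t := mul_pos (by nlinarith) ht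
  simp only [ψ] at hpos
  linear_combination hpos - h

theorem stmt_3 :
    (∀ f a, InClassB f a → ∀ z : ℂ, ‖z‖ ≤ (Real.sqrt 17 - 3) / 4 →
      Gexpr1 f a z ‖z‖ ((221 - 43 * Real.sqrt 17) / 64) ≤ 1) ∧
    (∀ lam' : ℝ, (221 - 43 * Real.sqrt 17) / 64 < lam' →
      ∃ f a, InClassB f a ∧ ∃ z : ℂ, ‖z‖ = (Real.sqrt 17 - 3) / 4 ∧
        1 < Gexpr1 f a z ((Real.sqrt 17 - 3) / 4) lam') := by
  have hs : Real.sqrt 17 ^ 2 = 17 := Real.sq_sqrt (by norm_num)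
  have hs3 : 3 < Real.sqrt 17 := Real.lt_sqrt_of_sq_lt (by norm_num)
  have hR : 2 * ((Real.sqrt 17 - 3) / 4) ^ 2 + 3 * ((Real.sqrt 17 - 3) / 4) = 1 := by
    linear_combination hs / 8
  have hlam : (221 - 43 * Real.sqrt 17) / 64 = (23 - 43 * ((Real.sqrt 17 - 3) / 4)) / 16 := by ring
  have hR0 : 0 < (Real.sqrt 17 - 3) / 4 := by linarith
  rw [hlam]
  refine ⟨fun f a hf z hz => hf.gexpr_le_one hR hz, fun lam' h => ?_⟩
  obtain ⟨t, ht0, ht1, ht⟩ := exists_one_lt_gexpr_diskAut hR hR0 h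
  refine ⟨_, _, inClassB_diskAut ht0 ht1, _, ?_, ht⟩
  rw [Complex.norm_real, Real.norm_of_nonneg hR0.le]
end

section
/- Let f(z) = Σ_{n=0}^∞ a_n z^n belong to the class B. Then for every N ∈ ℕ (N ≥ 1), with t = ⌊(N−1)/2⌋, and every r ∈ [0,1): Σ_{n=N}^∞ |a_n| r^n + sgn(t) · (Σ_{n=1}^{t} |a_n|²) · r^N/(1−r) + (1/(1+|a₀|) + r/(1−r)) Σ_{n=t+1}^∞ |a_n|² r^{2n} ≤ (1 − |a₀|²) r^N/(1−r), where sgn(t) = 0 if t = 0 and sgn(t) = 1 if t ≥ 1. -/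
theorem norm_fourier_apply {T : ℝ} (n : ℤ) (t : AddCircle T) : ‖fourier n t‖ = 1 := by
  rw [fourier_apply]
  exact Circle.norm_coe _

open Finset MeasureTheory AddCircle ComplexConjugate Filter Topology in
/-- The sesquilinear form attached to a symbol `F` on the circle is given by the Toeplitz matrix
of the Fourier coefficients of `F`. -/
theorem integral_mul_trigPoly_mul_conj (F : C(UnitAddCircle, ℂ)) (K : ℕ) (x z : ℕ → ℂ) :
    ∫ t, F t * (∑ j ∈ range K, x j * fourier (j : ℤ) t)
        * conj (∑ i ∈ range K, z i * fourier (i : ℤ) t) ∂haarAddCircle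
      = ∑ i ∈ range K, ∑ j ∈ range K, fourierCoeff F ((i : ℤ) - j) * x j * conj (z i) := by
  have expand (t : UnitAddCircle) : F t * (∑ j ∈ range K, x j * fourier (j : ℤ) t)
        * conj (∑ i ∈ range K, z i * fourier (i : ℤ) t)
      = ∑ i ∈ range K, ∑ j ∈ range K,
          (fourier (-((i : ℤ) - j)) t * F t) * (x j * conj (z i)) := by
    rw [map_sum, Finset.mul_sum]
    refine Finset.sum_congr rfl fun i _ => ?_
    rw [Finset.mul_sum, Finset.sum_mul]
    refine Finset.sum_congr rfl fun j _ => ?_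
    rw [neg_sub, sub_eq_add_neg, fourier_add, fourier_neg, map_mul]
    ring
  simp_rw [expand]
  have int (m : ℤ) (c : ℂ) :
      Integrable (fun t : UnitAddCircle => (fourier m t * F t) * c) haarAddCircle :=
    Continuous.integrable_of_hasCompactSupport (by fun_prop) (HasCompactSupport.of_compactSpace _)
  rw [integral_finsetSum _ fun i _ => integrable_finsetSum _ fun j _ => int _ _]
  refine Finset.sum_congr rfl fun i _ => ?_
  rw [integral_finsetSum _ fun j _ => int _ _]
  refine Finset.sum_congr rfl fun j _ => ?_
  rw [integral_mul_const, mul_assoc]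
  rfl

open Finset MeasureTheory AddCircle ComplexConjugate in
theorem integral_norm_sq_trigPoly (K : ℕ) (x : ℕ → ℂ) :
    ∫ t : UnitAddCircle, ‖∑ j ∈ range K, x j * fourier (j : ℤ) t‖ ^ 2 ∂haarAddCircle
      = ∑ j ∈ range K, ‖x j‖ ^ 2 := by
  have h := integral_mul_trigPoly_mul_conj (fourier 0) K x x
  simp only [fourierCoeff_fourier, fourier_zero, one_mul, Complex.mul_conj'] at h
  have h2 : ∑ i ∈ range K, ∑ j ∈ range K,
      (Pi.single 0 1 : ℤ → ℂ) ((i : ℤ) - j) * x j * conj (x i)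
      = ∑ i ∈ range K, ((‖x i‖ ^ 2 : ℝ) : ℂ) := by
    refine Finset.sum_congr rfl fun i hi => ?_
    rw [Finset.sum_eq_single_of_mem i hi]
    · simp [Complex.mul_conj']
    · intro j _ hj
      rw [Pi.single_eq_of_ne (by omega)]
      ring
  rw [h2] at h
  have h3 := congrArg Complex.re h
  norm_cast at h3

open Finset MeasureTheory AddCircle ComplexConjugate in
theorem norm_toeplitzForm_fourierCoeff_le (F : C(UnitAddCircle, ℂ)) (hF : ∀ t, ‖F t‖ ≤ 1) (K : ℕ)
    (x z : ℕ → ℂ) :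
    ‖∑ i ∈ range K, ∑ j ∈ range K, fourierCoeff F ((i : ℤ) - j) * x j * conj (z i)‖
      ≤ (∑ j ∈ range K, ‖x j‖ ^ 2 + ∑ i ∈ range K, ‖z i‖ ^ 2) / 2 := by
  rw [← integral_mul_trigPoly_mul_conj, ← integral_norm_sq_trigPoly K x,
    ← integral_norm_sq_trigPoly K z]
  have int (y : ℕ → ℂ) : Integrable
      (fun t : UnitAddCircle => ‖∑ j ∈ range K, y j * fourier (j : ℤ) t‖ ^ 2) haarAddCircle :=
    Continuous.integrable_of_hasCompactSupport (by fun_prop) (HasCompactSupport.of_compactSpace _)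
  rw [← integral_add (int x) (int z), ← integral_div]
  refine norm_integral_le_of_norm_le (((int x).add (int z)).div_const 2) (.of_forall fun t => ?_)
  rw [norm_mul, norm_mul, RCLike.norm_conj]
  set p := ‖∑ j ∈ range K, x j * fourier (j : ℤ) t‖
  set q := ‖∑ j ∈ range K, z j * fourier (j : ℤ) t‖
  have hp : 0 ≤ p := norm_nonneg _
  have hq : 0 ≤ q := norm_nonneg _
  have : ‖F t‖ * p * q ≤ 1 * p * q := by gcongr; exact hF t
  change _ ≤ (p ^ 2 + q ^ 2) / 2
  nlinarith [sq_nonneg (p - q)]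

open MeasureTheory AddCircle in
theorem fourierCoeff_of_hasSum (c : ℕ → ℂ) (hc : Summable fun n => ‖c n‖)
    (F : UnitAddCircle → ℂ) (hF : ∀ t, HasSum (fun n : ℕ => c n * fourier (n : ℤ) t) (F t))
    (i j : ℕ) : fourierCoeff F ((i : ℤ) - j) = if j ≤ i then c (i - j) else 0 := by
  set m : ℤ := (i : ℤ) - j with hm
  have hsum : HasSum (fun n : ℕ => ∫ t : UnitAddCircle,
      fourier (-m) t • (c n * fourier (n : ℤ) t) ∂haarAddCircle) (fourierCoeff F m) := by
    have h := hasSum_integral_of_summable_integral_norm (μ := haarAddCircle)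
      (F := fun (n : ℕ) (t : UnitAddCircle) => fourier (T := 1) (-m) t • (c n * fourier (n : ℤ) t))
      (fun n => Continuous.integrable_of_hasCompactSupport (by fun_prop)
        (HasCompactSupport.of_compactSpace _)) 
      (by simpa only [norm_smul, norm_mul, norm_fourier_apply, one_mul, mul_one, integral_const,
        probReal_univ, one_smul] using hc)
    have tsum_eq : fourierCoeff F m = ∫ t : UnitAddCircle,
        ∑' n : ℕ, fourier (-m) t • (c n * fourier (n : ℤ) t) ∂haarAddCircle :=
      integral_congr_ae (.of_forall fun t =>
        ((hF t).const_smul (fourier (T := 1) (-m) t)).tsum_eq.symm)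
    rwa [tsum_eq]
  have term (n : ℕ) : ∫ t : UnitAddCircle,
      fourier (-m) t • (c n * fourier (n : ℤ) t) ∂haarAddCircle
      = c n * (Pi.single (n : ℤ) 1 : ℤ → ℂ) m := by
    rw [← fourierCoeff_fourier (T := 1), ← fourierCoeff.const_mul]
    rfl
  simp_rw [term] at hsum
  refine hsum.unique ?_
  split_ifs with hij
  · convert hasSum_single (i - j) ?_ using 1
    · have : m = ((i - j : ℕ) : ℤ) := by omega
      simp [this]
    · intro n hn
      rw [Pi.single_eq_of_ne (by omega), mul_zero]
  · convert hasSum_zero using 2 with n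
    rw [Pi.single_eq_of_ne (by omega), mul_zero]

open Finset AddCircle ComplexConjugate Filter Topology in
/-- Lower triangular Toeplitz matrices of a function in the class `B` are contractions. -/
theorem InClassB.norm_toeplitzForm_le {f : ℂ → ℂ} {a : ℕ → ℂ} (hf : InClassB f a) (K : ℕ)
    (x z : ℕ → ℂ) :
    ‖∑ i ∈ range K, ∑ j ∈ range K, (if j ≤ i then a (i - j) else 0) * x j * conj (z i)‖
      ≤ (∑ j ∈ range K, ‖x j‖ ^ 2 + ∑ i ∈ range K, ‖z i‖ ^ 2) / 2 := by
  have inner (r : ℝ) (hr : r ∈ Set.Ioo (0 : ℝ) 1) :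
      ‖∑ i ∈ range K, ∑ j ∈ range K,
        (if j ≤ i then a (i - j) * (r : ℂ) ^ (i - j) else 0) * x j * conj (z i)‖
      ≤ (∑ j ∈ range K, ‖x j‖ ^ 2 + ∑ i ∈ range K, ‖z i‖ ^ 2) / 2 := by
    have hc : Summable fun n => ‖a n * (r : ℂ) ^ n‖ :=
      (hf.1 r (by simpa [abs_of_pos hr.1] using hr.2)).summable.norm
    have hr' (t : UnitAddCircle) : ‖(r : ℂ) * fourier 1 t‖ < 1 := by
      rw [norm_mul, norm_fourier_apply, mul_one]
      simpa [abs_of_pos hr.1] using hr.2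
    have hF (t : UnitAddCircle) : HasSum (fun n : ℕ => a n * (r : ℂ) ^ n * fourier (n : ℤ) t)
        (f (r * fourier 1 t)) := by
      convert hf.1 _ (hr' t) using 2 with n
      rw [mul_pow, mul_assoc, fourier_apply, fourier_apply, one_smul, AddCircle.toCircle_zsmul]
      simp
    have cont : Continuous fun t : UnitAddCircle => f (r * fourier 1 t) := by
      have : (fun t : UnitAddCircle => f (r * fourier 1 t))
          = fun t => ∑' n : ℕ, a n * (r : ℂ) ^ n * fourier (n : ℤ) t :=
        funext fun t => (hF t).tsum_eq.symm
      rw [this]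
      exact continuous_tsum (fun n => by fun_prop) hc fun n t => by
        rw [norm_mul, norm_fourier_apply, mul_one]
    have h := norm_toeplitzForm_fourierCoeff_le ⟨_, cont⟩ (fun t => hf.2 _ (hr' t)) K x z
    simpa only [ContinuousMap.coe_mk, fourierCoeff_of_hasSum _ hc _ hF] using h
  have lim : Tendsto (fun r : ℝ => ‖∑ i ∈ range K, ∑ j ∈ range K,
        (if j ≤ i then a (i - j) * (r : ℂ) ^ (i - j) else 0) * x j * conj (z i)‖) (𝓝[<] 1)
      (𝓝 ‖∑ i ∈ range K, ∑ j ∈ range K, (if j ≤ i then a (i - j) else 0) * x j * conj (z i)‖) := by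
    refine tendsto_nhdsWithin_of_tendsto_nhds ?_
    refine Continuous.tendsto' ?_ _ _ (by simp)
    refine Continuous.norm (continuous_finsetSum _ fun i _ => continuous_finsetSum _ fun j _ => ?_)
    split_ifs <;> fun_prop
  exact le_of_tendsto lim (Filter.mem_of_superset (Ioo_mem_nhdsLT zero_lt_one) inner)

open Finset ComplexConjugate in
/-- Carlson's coefficient inequalities for the class `B`, with the odd and the even case
written in one formula. -/
theorem InClassB.norm_coeff_add_sum_le {f : ℂ → ℂ} {a : ℕ → ℂ} (hf : InClassB f a) {n : ℕ}
    (hn : 1 ≤ n) :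
    ‖a n‖ + ∑ k ∈ range (n + 1),
      (if 2 * k < n then 1 else if 2 * k = n then 1 / (1 + ‖a 0‖) else 0) * ‖a k‖ ^ 2 ≤ 1 := by
  set l : ℝ := 1 / (1 + ‖a 0‖) with hl
  set c : ℕ → ℝ := fun k => if 2 * k < n then 1 else if 2 * k = n then l else 0 with hc
  obtain ⟨u, hu, hau⟩ : ∃ u : ℂ, ‖u‖ = 1 ∧ a n = u * ‖a n‖ := by
    by_cases h : a n = 0
    · exact ⟨1, by simp, by simp [h]⟩
    · have h' : (‖a n‖ : ℂ) ≠ 0 := by simpa using h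
      refine ⟨a n / ‖a n‖, by simp [h], by field_simp⟩
  set x : ℕ → ℂ := fun j => (if j = 0 then 1 else 0) + u * (c (n - j) * conj (a (n - j))) with hx
  set z : ℕ → ℂ := fun i => (if i = n then 1 else 0) + conj u * (c i * a i) with hz
  have cn : c n = 0 := by
    simp only [hc]
    rw [if_neg (by omega), if_neg (by omega)]
  have form : ∑ i ∈ range (n + 1), ∑ j ∈ range (n + 1),
      (if j ≤ i then a (i - j) else 0) * x j * conj (z i)
      = u * (‖a n‖ + 2 * ∑ k ∈ range (n + 1), (c k : ℂ) * (‖a k‖ : ℂ) ^ 2)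
        + u ^ 2 * ∑ k ∈ range (n + 1), if 2 * k = n then (l : ℂ) ^ 2 * a 0 * conj (a k) ^ 2
            else 0 := by
    have row (i : ℕ) (hi : i ≤ n) :
        ∑ j ∈ range (n + 1), (if j ≤ i then a (i - j) else 0) * x j
        = a i + u * ∑ k ∈ range (n + 1),
            (if n - k ≤ i then a (i - (n - k)) else 0) * (c k * conj (a k)) := by
      rw [← Finset.sum_range_reflect (fun k => (if n - k ≤ i then a (i - (n - k)) else 0)
        * (c k * conj (a k))), Finset.mul_sum]
      simp only [hx, mul_add, Finset.sum_add_distrib]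
      congr 1
      · rw [Finset.sum_eq_single_of_mem 0 (by simp)]
        · simp
        · intro j _ hj
          simp [hj]
      · refine Finset.sum_congr rfl fun j hj => ?_
        rw [Finset.mem_range] at hj
        rw [Nat.add_sub_cancel, Nat.sub_sub_self (by omega)]
        ring
    have last_row : ∑ k ∈ range (n + 1),
          (if n - k ≤ n then a (n - (n - k)) else 0) * (c k * conj (a k))
        = ∑ k ∈ range (n + 1), (c k : ℂ) * (‖a k‖ : ℂ) ^ 2 := by
      refine Finset.sum_congr rfl fun k hk => ?_
      rw [Finset.mem_range] at hk
      rw [if_pos (by omega), Nat.sub_sub_self (by omega), ← Complex.mul_conj']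
      ring
    have diag (i : ℕ) (hi : i ≤ n) : (c i * conj (a i)) * ∑ k ∈ range (n + 1),
          (if n - k ≤ i then a (i - (n - k)) else 0) * (c k * conj (a k))
        = if 2 * i = n then (l : ℂ) ^ 2 * a 0 * conj (a i) ^ 2 else 0 := by
      rw [Finset.mul_sum, Finset.sum_eq_single_of_mem i (by simp; omega)]
      · by_cases h : 2 * i = n
        · have hci : c i = l := by
            simp only [hc]
            rw [if_neg (by omega), if_pos h]
          rw [if_pos (by omega), if_pos h, hci, show i - (n - i) = 0 by omega]
          ring
        · rw [if_neg h]
          by_cases h' : n - i ≤ i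
          · have hci : c i = 0 := by
              simp only [hc]
              rw [if_neg (by omega), if_neg h]
            simp [hci]
          · rw [if_neg h']
            ring
      · intro k hk hki
        rw [Finset.mem_range] at hk
        by_cases h : n - k ≤ i
        · have hck : c i = 0 ∨ c k = 0 := by
            rcases lt_or_ge n (2 * i) with h' | h'
            · left
              simp only [hc]
              rw [if_neg (by omega), if_neg (by omega)]
            · right
              simp only [hc]
              rw [if_neg (by omega), if_neg (by omega)]
          rcases hck with h' | h' <;> simp [h']
        · rw [if_neg h]
          ring
    have step (i : ℕ) (hi : i ∈ range (n + 1)) :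
        ∑ j ∈ range (n + 1), (if j ≤ i then a (i - j) else 0) * x j * conj (z i)
        = (if i = n then a n + u * ∑ k ∈ range (n + 1), (c k : ℂ) * (‖a k‖ : ℂ) ^ 2 else 0)
          + u * ((c i : ℂ) * (‖a i‖ : ℂ) ^ 2)
          + u ^ 2 * if 2 * i = n then (l : ℂ) ^ 2 * a 0 * conj (a i) ^ 2 else 0 := by
      have hi' : i ≤ n := by simpa [Nat.lt_succ_iff] using hi
      have hconj : conj (z i) = (if i = n then 1 else 0) + u * (c i * conj (a i)) := by
        simp only [hz, map_add, map_mul, Complex.conj_conj, Complex.conj_ofReal]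
        split_ifs <;> simp
      rw [← Finset.sum_mul, row i hi', hconj, ← diag i hi', ← Complex.mul_conj']
      split_ifs with h
      · subst h
        rw [last_row]
        ring
      · ring
    rw [Finset.sum_congr rfl step, Finset.sum_add_distrib, Finset.sum_add_distrib,
      Finset.sum_ite_eq' (range (n + 1)) n, if_pos (by simp), ← Finset.mul_sum, ← Finset.mul_sum]
    linear_combination hau
  have normx : ∑ j ∈ range (n + 1), ‖x j‖ ^ 2 = 1 + ∑ k ∈ range (n + 1), c k ^ 2 * ‖a k‖ ^ 2 := by
    rw [← Finset.sum_range_reflect (fun k => c k ^ 2 * ‖a k‖ ^ 2), Finset.sum_range_succ',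
      Finset.sum_range_succ']
    simp [hx, cn, hu, mul_pow, add_comm]
  have normz : ∑ i ∈ range (n + 1), ‖z i‖ ^ 2 = 1 + ∑ k ∈ range (n + 1), c k ^ 2 * ‖a k‖ ^ 2 := by
    rw [Finset.sum_range_succ, Finset.sum_range_succ]
    have : ∑ i ∈ range n, ‖z i‖ ^ 2 = ∑ k ∈ range n, c k ^ 2 * ‖a k‖ ^ 2 := by
      refine Finset.sum_congr rfl fun i hi => ?_
      rw [Finset.mem_range] at hi
      simp [hz, hu, mul_pow, hi.ne]
    rw [this]
    simp [hz, cn, add_comm]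
  have key := hf.norm_toeplitzForm_le (n + 1) x z
  rw [form, normx, normz] at key
  set R : ℂ := ∑ k ∈ range (n + 1), if 2 * k = n then (l : ℂ) ^ 2 * a 0 * conj (a k) ^ 2 else 0
    with hR
  have normR : ‖R‖ ≤ ∑ k ∈ range (n + 1), if 2 * k = n then l ^ 2 * ‖a 0‖ * ‖a k‖ ^ 2 else 0 := by
    refine (norm_sum_le _ _).trans (Finset.sum_le_sum fun k _ => ?_)
    split_ifs <;> simp
  have main : ‖a n‖ + 2 * ∑ k ∈ range (n + 1), c k * ‖a k‖ ^ 2 ≤ 1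
      + ∑ k ∈ range (n + 1), c k ^ 2 * ‖a k‖ ^ 2 + ‖R‖ := by
    have h1 := norm_sub_le_norm_add
      (u * (‖a n‖ + 2 * ∑ k ∈ range (n + 1), (c k : ℂ) * (‖a k‖ : ℂ) ^ 2)) (u ^ 2 * R)
    rw [norm_mul, norm_mul, norm_pow, hu, one_pow, one_mul, one_mul] at h1
    have h2 := Complex.re_le_norm (‖a n‖ + 2 * ∑ k ∈ range (n + 1), (c k : ℂ) * (‖a k‖ : ℂ) ^ 2)
    norm_cast at h2 h1 key
    linarith
  have combine : 2 * ∑ k ∈ range (n + 1), c k * ‖a k‖ ^ 2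
      = ∑ k ∈ range (n + 1), c k ^ 2 * ‖a k‖ ^ 2
        + (∑ k ∈ range (n + 1), if 2 * k = n then l ^ 2 * ‖a 0‖ * ‖a k‖ ^ 2 else 0)
        + ∑ k ∈ range (n + 1), c k * ‖a k‖ ^ 2 := by
    rw [← Finset.sum_add_distrib, ← Finset.sum_add_distrib, Finset.mul_sum]
    refine Finset.sum_congr rfl fun k _ => ?_
    have hl2 : l ^ 2 * (1 + ‖a 0‖) = l := by
      rw [hl]
      field_simp
    simp only [hc]
    rcases lt_trichotomy (2 * k) n with h | h | h
    · rw [if_pos h, if_neg h.ne]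
      ring
    · rw [if_neg h.not_lt, if_pos h, if_pos h]
      linear_combination -‖a k‖ ^ 2 * hl2
    · rw [if_neg h.not_gt, if_neg h.ne', if_neg h.ne']
      ring
  linarith

theorem hasSum_carlsonWeight {r : ℝ} (hr0 : 0 ≤ r) (hr1 : r < 1) (l : ℝ) (N k : ℕ) :
    HasSum (fun n : ℕ =>
        (if 2 * k < n + N then 1 else if 2 * k = n + N then l else 0) * r ^ (n + N))
      (if 2 * k < N then r ^ N / (1 - r) else (l + r / (1 - r)) * r ^ (2 * k)) := by
  have geom (m : ℕ) : HasSum (fun n : ℕ => r ^ (n + m)) (r ^ m / (1 - r)) := by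
    simpa [pow_add, div_eq_inv_mul] using (hasSum_geometric_of_lt_one hr0 hr1).mul_right (r ^ m)
  split_ifs with h
  · convert geom N using 2 with n
    rw [if_pos (by omega), one_mul]
  · refine (hasSum_nat_add_iff' (2 * k - N + 1)).mp ?_
    rw [Finset.sum_range_succ, Finset.sum_eq_zero, zero_add, if_neg (by omega),
      if_pos (by omega), Nat.sub_add_cancel (by omega),
      show (l + r / (1 - r)) * r ^ (2 * k) - l * r ^ (2 * k) = r ^ (2 * k + 1) / (1 - r) by ring]
    · refine (geom (2 * k + 1)).congr_fun fun n => ?_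
      rw [if_pos (by omega), one_mul]
      congr 1
      omega
    · intro n hn
      rw [Finset.mem_range] at hn
      rw [if_neg (by omega), if_neg (by omega), zero_mul]

open Finset in
theorem InClassB.tsum_add_weighted_sum_le {f : ℂ → ℂ} {a : ℕ → ℂ} (hf : InClassB f a) {N : ℕ}
    (hN : 1 ≤ N) {r : ℝ} (hr0 : 0 ≤ r) (hr1 : r < 1) (K : ℕ) :
    (∑' n : ℕ, ‖a (n + N)‖ * r ^ (n + N))
      + ∑ k ∈ range K, (if 2 * k < N then r ^ N / (1 - r)
          else (1 / (1 + ‖a 0‖) + r / (1 - r)) * r ^ (2 * k)) * ‖a k‖ ^ 2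
      ≤ r ^ N / (1 - r) := by
  set l : ℝ := 1 / (1 + ‖a 0‖)
  have hl : 0 ≤ l := by positivity
  set w : ℕ → ℕ → ℝ := fun n k => if 2 * k < n then 1 else if 2 * k = n then l else 0
  have hw (n k : ℕ) : 0 ≤ w n k := by
    simp only [w]
    split_ifs <;> positivity
  have bound (n : ℕ) (hn : 1 ≤ n) : ‖a n‖ + ∑ k ∈ range K, w n k * ‖a k‖ ^ 2 ≤ 1 := by
    refine le_trans (add_le_add_right ?_ _) (hf.norm_coeff_add_sum_le hn)
    rw [← Finset.sum_filter_ne_zero]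
    refine Finset.sum_le_sum_of_subset_of_nonneg (fun k hk => ?_)
      fun k _ _ => mul_nonneg (hw n k) (by positivity)
    by_contra hkn
    rw [Finset.mem_range] at hkn
    refine (Finset.mem_filter.mp hk).2 ?_
    simp only [w]
    rw [if_neg (by omega), if_neg (by omega), zero_mul]
  have geom : HasSum (fun n : ℕ => r ^ (n + N)) (r ^ N / (1 - r)) := by
    simpa [pow_add, div_eq_inv_mul] using (hasSum_geometric_of_lt_one hr0 hr1).mul_right (r ^ N)
  have le_one (n : ℕ) (hn : 1 ≤ n) : ‖a n‖ ≤ 1 := by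
    have : 0 ≤ ∑ k ∈ range K, w n k * ‖a k‖ ^ 2 :=
      Finset.sum_nonneg fun k _ => mul_nonneg (hw n k) (by positivity)
    linarith [bound n hn]
  have sa : Summable fun n : ℕ => ‖a (n + N)‖ * r ^ (n + N) :=
    Summable.of_nonneg_of_le (fun n => by positivity)
      (fun n => mul_le_of_le_one_left (by positivity) (le_one _ (by omega))) geom.summable
  have sw := hasSum_sum fun k (_ : k ∈ range K) =>
    (hasSum_carlsonWeight hr0 hr1 l N k).mul_right (‖a k‖ ^ 2)
  refine hasSum_le (fun n => ?_) (sa.hasSum.add sw) geom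
  have hb := mul_le_mul_of_nonneg_right (bound (n + N) (by omega)) (pow_nonneg hr0 (n + N))
  rw [add_mul, one_mul, Finset.sum_mul] at hb
  refine le_trans (le_of_eq ?_) hb
  congr 1
  exact Finset.sum_congr rfl fun k _ => by simp only [w]; ring

theorem stmt_12 (f : ℂ → ℂ) (a : ℕ → ℂ) (hf : InClassB f a)
    (N : ℕ) (hN : 1 ≤ N) (r : ℝ) (hr0 : 0 ≤ r) (hr1 : r < 1) :
    (∑' n : ℕ, ‖a (n + N)‖ * r ^ (n + N))
      + (if (N - 1) / 2 = 0 then (0 : ℝ) else 1)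
          * (∑ n ∈ Finset.Icc 1 ((N - 1) / 2), ‖a n‖ ^ 2) * (r ^ N / (1 - r))
      + (1 / (1 + ‖a 0‖) + r / (1 - r))
          * (∑' n : ℕ, ‖a (n + ((N - 1) / 2 + 1))‖ ^ 2 * r ^ (2 * (n + ((N - 1) / 2 + 1))))
      ≤ (1 - ‖a 0‖ ^ 2) * r ^ N / (1 - r) := by
  have hr : 0 < 1 - r := by linarith
  set t := (N - 1) / 2 with ht
  have sgn : (if t = 0 then (0 : ℝ) else 1) * (∑ n ∈ Finset.Icc 1 t, ‖a n‖ ^ 2)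
      = ∑ n ∈ Finset.Icc 1 t, ‖a n‖ ^ 2 := by
    split_ifs with h <;> simp [h]
  have head : ∑ k ∈ Finset.range (t + 1), ‖a k‖ ^ 2
      = ‖a 0‖ ^ 2 + ∑ n ∈ Finset.Icc 1 t, ‖a n‖ ^ 2 := by
    rw [Finset.range_eq_Ico, Finset.sum_eq_sum_Ico_succ_bot (by omega)]
    rfl
  rw [sgn, ← tsum_mul_left, ← le_sub_iff_add_le']
  refine Real.tsum_le_of_sum_range_le (fun n => by positivity) fun K => ?_
  have key := hf.tsum_add_weighted_sum_le hN hr0 hr1 (t + 1 + K)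
  rw [Finset.sum_range_add] at key
  have low : ∑ k ∈ Finset.range (t + 1), (if 2 * k < N then r ^ N / (1 - r)
        else (1 / (1 + ‖a 0‖) + r / (1 - r)) * r ^ (2 * k)) * ‖a k‖ ^ 2
      = (r ^ N / (1 - r)) * (‖a 0‖ ^ 2 + ∑ n ∈ Finset.Icc 1 t, ‖a n‖ ^ 2) := by
    rw [← head, Finset.mul_sum]
    refine Finset.sum_congr rfl fun k hk => ?_
    rw [Finset.mem_range] at hk
    rw [if_pos (by omega)]
  have high : ∑ k ∈ Finset.range K, (if 2 * (t + 1 + k) < N then r ^ N / (1 - r)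
        else (1 / (1 + ‖a 0‖) + r / (1 - r)) * r ^ (2 * (t + 1 + k))) * ‖a (t + 1 + k)‖ ^ 2
      = ∑ n ∈ Finset.range K, (1 / (1 + ‖a 0‖) + r / (1 - r))
          * (‖a (n + (t + 1))‖ ^ 2 * r ^ (2 * (n + (t + 1)))) := by
    refine Finset.sum_congr rfl fun k _ => ?_
    rw [if_neg (by omega), add_comm k]
    ring
  rw [low, high] at key
  rw [mul_div_assoc]
  linarith
end

section
/- Let f belong to the class B. Then for every integer k ≥ 1 and every z with |z| < 1, the k-th derivative of f satisfies |f^{(k)}(z)| ≤ k! (1 − |f(z)|²) (1 + |z|)^{k−1} / (1 − |z|²)^k. -/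
open Metric Filter Topology Finset ComplexConjugate

theorem norm_one_sub_conj_mul_sq_sub (a b : ℂ) :
    ‖1 - conj a * b‖ ^ 2 - ‖b - a‖ ^ 2 = (1 - ‖a‖ ^ 2) * (1 - ‖b‖ ^ 2) := by
  simp only [← Complex.normSq_eq_norm_sq, Complex.normSq_apply, Complex.sub_re, Complex.sub_im,
    Complex.mul_re, Complex.mul_im, Complex.conj_re, Complex.conj_im, Complex.one_re,
    Complex.one_im]
  ring

theorem one_add_conj_mul_ne_zero {a b : ℂ} (ha : ‖a‖ < 1) (hb : ‖b‖ < 1) :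
    1 + conj a * b ≠ 0 := by
  intro h
  have h1 : ‖conj a * b‖ = 1 := by
    rw [show conj a * b = -1 by linear_combination h]; simp
  rw [norm_mul, Complex.norm_conj] at h1
  nlinarith [norm_nonneg a, norm_nonneg b]

theorem norm_one_sub_conj_mul_self {a : ℂ} (ha : ‖a‖ ≤ 1) : ‖1 - conj a * a‖ = 1 - ‖a‖ ^ 2 := by
  rw [Complex.conj_mul', show (1 : ℂ) - (‖a‖ : ℂ) ^ 2 = ((1 - ‖a‖ ^ 2 : ℝ) : ℂ) by push_cast; ring,
    Complex.norm_real, Real.norm_of_nonneg]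
  nlinarith [norm_nonneg a]

theorem norm_iteratedDeriv_zero_le_of_lacunary {F : ℂ → ℂ} {n : ℕ} (hn : n ≠ 0)
    (hF : DifferentiableOn ℂ F (ball 0 1)) (hb : ∀ w ∈ ball (0 : ℂ) 1, ‖F w‖ < 1)
    (h0 : ∀ m, 0 < m → m < n → iteratedDeriv m F 0 = 0) :
    ‖iteratedDeriv n F 0‖ ≤ n.factorial * (1 - ‖F 0‖ ^ 2) := by
  have h00 : (0 : ℂ) ∈ ball (0 : ℂ) 1 := by simp
  have hFa : AnalyticAt ℂ F 0 := hF.analyticAt (isOpen_ball.mem_nhds h00)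
  set a := F 0 with ha
  have ha1 : ‖a‖ < 1 := hb 0 h00
  have hne : ∀ w ∈ ball (0 : ℂ) 1, 1 - conj a * F w ≠ 0 := fun w hw ↦ by
    simpa [sub_eq_add_neg] using
      one_add_conj_mul_ne_zero ha1 (b := -F w) (by simpa using hb w hw)
  obtain ⟨G, hG, hFG⟩ : ∃ G, AnalyticAt ℂ G 0 ∧
      ∀ᶠ w in 𝓝 0, F w - a = (w - 0) ^ n • G w := by
    rw [← natCast_le_analyticOrderAt (by fun_prop),
      natCast_le_analyticOrderAt_iff_iteratedDeriv_eq_zero (by fun_prop)]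
    intro m hm
    rcases Nat.eq_zero_or_pos m with rfl | hm0
    · simp [ha]
    · simp only [sub_eq_neg_add]
      rw [iteratedDeriv_const_add hm0, h0 m hm0 hm]
  simp only [sub_zero, smul_eq_mul] at hFG
  have hGn : iteratedDeriv n F 0 = n.factorial * G 0 := by
    have h1 : F =ᶠ[𝓝 0] fun w ↦ a + w ^ n * G w := by
      filter_upwards [hFG] with w hw
      rw [← hw]; ring
    rw [h1.iteratedDeriv_eq, iteratedDeriv_const_add (Nat.pos_of_ne_zero hn),
      iteratedDeriv_fun_mul (by fun_prop) hG.contDiffAt, Finset.sum_range_succ,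
      Finset.sum_eq_zero]
    · simp [Nat.descFactorial_self]
    · intro i hi
      have : n - i ≠ 0 := Nat.sub_ne_zero_of_lt (Finset.mem_range.1 hi)
      simp [this]
  set h : ℂ → ℂ := fun w ↦ (F w - a) / (1 - conj a * F w) with hh
  have hh0 : h 0 = 0 := by simp [hh, ha]
  have hcont : ContinuousAt F 0 := hFa.continuousAt
  have hO : (h · - h 0) =o[𝓝 0] (fun w : ℂ ↦ ‖w - 0‖ ^ (n - 1)) := by
    have h1 : (fun w ↦ h w - h 0) =ᶠ[𝓝 0]
        fun w ↦ w ^ n * (G w / (1 - conj a * F w)) := by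
      filter_upwards [hFG] with w hw
      rw [hh0, sub_zero, hh, ← mul_div_assoc, ← hw]
    refine h1.trans_isLittleO ?_
    have h2 : (fun w : ℂ ↦ w ^ n) =o[𝓝 0] fun w : ℂ ↦ w ^ (n - 1) :=
      Asymptotics.isLittleO_pow_pow (by omega)
    have h3 : (fun w ↦ G w / (1 - conj a * F w)) =O[𝓝 0] fun _ ↦ (1 : ℂ) := by
      exact (hG.continuousAt.div (by fun_prop) (hne 0 h00)).tendsto.isBigO_one ℂ
    have h4 := (h2.mul_isBigO h3).norm_right
    simpa using h4
  have hd : DifferentiableOn ℂ h (ball 0 1) :=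
    (hF.sub_const a).div ((hF.const_mul _).const_sub 1) hne
  have hmaps : Set.MapsTo h (ball 0 1) (closedBall (h 0) 1) := by
    intro w hw
    rw [hh0, mem_closedBall_zero_iff, hh, norm_div]
    refine div_le_one_of_le₀ ?_ (norm_nonneg _)
    refine (pow_le_pow_iff_left₀ (norm_nonneg _) (norm_nonneg _) two_ne_zero).1 ?_
    have h1 := norm_one_sub_conj_mul_sq_sub a (F w)
    have h2 : 0 ≤ (1 - ‖a‖ ^ 2) * (1 - ‖F w‖ ^ 2) := by
      have := hb w hw
      have := norm_nonneg a
      have := norm_nonneg (F w)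
      exact mul_nonneg (by nlinarith) (by nlinarith)
    linarith
  have key : ∀ᶠ w in 𝓝[≠] (0 : ℂ), ‖G w‖ ≤ ‖1 - conj a * F w‖ := by
    filter_upwards [hFG.filter_mono nhdsWithin_le_nhds, self_mem_nhdsWithin,
      nhdsWithin_le_nhds (isOpen_ball.mem_nhds h00)] with w hw hw0 hwb
    have h1 := Complex.dist_le_mul_div_pow_of_mapsTo_ball_of_isLittleO hd hmaps hO hwb
    rw [hh0, Nat.sub_add_cancel (Nat.pos_of_ne_zero hn), dist_zero_right, dist_zero_right,
      div_one, one_mul] at h1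
    simp only [hh, hw, norm_div, norm_mul, norm_pow] at h1
    have hwp : 0 < ‖w‖ ^ n := pow_pos (norm_pos_iff.2 hw0) n
    rw [div_le_iff₀ (norm_pos_iff.2 (hne w hwb))] at h1
    exact le_of_mul_le_mul_left h1 hwp
  have hlim : ‖G 0‖ ≤ ‖1 - conj a * a‖ := by
    refine le_of_tendsto_of_tendsto
      (hG.continuousAt.norm.tendsto.mono_left nhdsWithin_le_nhds) ?_ key
    have : ContinuousAt (fun w ↦ ‖1 - conj a * F w‖) 0 := by fun_prop
    exact this.tendsto.mono_left nhdsWithin_le_nhds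
  rw [hGn, norm_mul, Complex.norm_natCast, ← norm_one_sub_conj_mul_self ha1.le]
  gcongr

theorem norm_iteratedDeriv_zero_le_of_norm_lt_one {g : ℂ → ℂ} {n : ℕ} (hn : n ≠ 0)
    (hg : DifferentiableOn ℂ g (ball 0 1)) (hb : ∀ w ∈ ball (0 : ℂ) 1, ‖g w‖ < 1) :
    ‖iteratedDeriv n g 0‖ ≤ n.factorial * (1 - ‖g 0‖ ^ 2) := by
  have h00 : (0 : ℂ) ∈ ball (0 : ℂ) 1 := by simp
  have hω := Complex.isPrimitiveRoot_exp n hn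
  set ω := Complex.exp (2 * Real.pi * Complex.I / n)
  have hn0 : (n : ℂ) ≠ 0 := mod_cast hn
  have hmaps (j : ℕ) : Set.MapsTo (ω ^ j * ·) (ball (0 : ℂ) 1) (ball 0 1) := by
    intro w hw
    simpa [hω.norm'_eq_one hn] using hw
  have hcomp (j : ℕ) : DifferentiableOn ℂ (fun w ↦ g (ω ^ j * w)) (ball 0 1) :=
    hg.comp (by fun_prop) (hmaps j)
  have hderiv (m j : ℕ) :
      iteratedDeriv m (fun w ↦ g (ω ^ j * w)) 0 = (ω ^ j) ^ m * iteratedDeriv m g 0 := by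
    have := iteratedDerivWithin_comp_const_smul (n := m) h00 isOpen_ball.uniqueDiffOn
      (hg.contDiffOn isOpen_ball) (ω ^ j) (hmaps j)
    rw [iteratedDerivWithin_of_isOpen isOpen_ball h00, mul_zero,
      iteratedDerivWithin_of_isOpen isOpen_ball h00] at this
    simpa using this
  set F : ℂ → ℂ := fun w ↦ (n : ℂ)⁻¹ * ∑ j ∈ range n, g (ω ^ j * w) with hF
  have hFd : DifferentiableOn ℂ F (ball 0 1) :=
    (DifferentiableOn.fun_sum fun j _ ↦ hcomp j).const_mul _
  have hFm (m : ℕ) :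
      iteratedDeriv m F 0 = (n : ℂ)⁻¹ * ((∑ j ∈ range n, (ω ^ m) ^ j) * iteratedDeriv m g 0) := by
    rw [hF, iteratedDeriv_const_mul_field, iteratedDeriv_fun_sum, Finset.sum_mul]
    · simp only [hderiv, ← pow_mul, mul_comm m]
    · intro j _
      exact ((hcomp j).analyticAt (isOpen_ball.mem_nhds h00)).contDiffAt
  have hF0 : F 0 = g 0 := by simp [hF, hn0]
  have hFn : iteratedDeriv n F 0 = iteratedDeriv n g 0 := by
    simp [hFm, hω.pow_eq_one, hn0]
  rw [← hF0, ← hFn]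
  refine norm_iteratedDeriv_zero_le_of_lacunary hn hFd ?_ ?_
  · intro w hw
    rw [hF]
    simp only [norm_mul, norm_inv, Complex.norm_natCast]
    rw [inv_mul_lt_iff₀ (by positivity)]
    calc _ ≤ ∑ j ∈ range n, ‖g (ω ^ j * w)‖ := norm_sum_le _ _
      _ < ∑ j ∈ range n, (1 : ℝ) :=
        Finset.sum_lt_sum_of_nonempty (by simpa using hn) fun j _ ↦ hb _ (hmaps j hw)
      _ = n * 1 := by simp
  · intro m hm hmn
    have h1 : ω ^ m ≠ 1 := hω.pow_ne_one_of_pos_of_lt hm.ne' hmn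
    have h2 : (∑ j ∈ range n, (ω ^ m) ^ j) = 0 := by
      rw [geom_sum_eq h1, ← pow_mul, mul_comm, pow_mul, hω.pow_eq_one]
      simp
    rw [hFm, h2]
    simp

theorem norm_iteratedDeriv_zero_le_of_norm_le_one {g : ℂ → ℂ} {n : ℕ} (hn : n ≠ 0)
    (hg : DifferentiableOn ℂ g (ball 0 1)) (hb : ∀ w ∈ ball (0 : ℂ) 1, ‖g w‖ ≤ 1) :
    ‖iteratedDeriv n g 0‖ ≤ n.factorial * (1 - ‖g 0‖ ^ 2) := by
  have key : ∀ᶠ r in 𝓝[<] (1 : ℝ),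
      r * ‖iteratedDeriv n g 0‖ ≤ n.factorial * (1 - (r * ‖g 0‖) ^ 2) := by
    filter_upwards [Ioo_mem_nhdsLT (show (0 : ℝ) < 1 by simp)] with r hr
    have h1 := norm_iteratedDeriv_zero_le_of_norm_lt_one (g := fun w ↦ (r : ℂ) * g w) hn
      (hg.const_mul _) fun w hw ↦ by
        rw [norm_mul, Complex.norm_real, Real.norm_of_nonneg hr.1.le]
        nlinarith [hb w hw, hr.1, hr.2]
    rw [iteratedDeriv_const_mul_field] at h1
    simpa [abs_of_pos hr.1] using h1
  have hlim (u : ℝ → ℝ) (hu : Continuous u) : Tendsto u (𝓝[<] 1) (𝓝 (u 1)) :=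
    hu.continuousAt.tendsto.mono_left nhdsWithin_le_nhds
  simpa using le_of_tendsto_of_tendsto
    (hlim (fun r ↦ r * ‖iteratedDeriv n g 0‖) (by fun_prop))
    (hlim (fun r ↦ n.factorial * (1 - (r * ‖g 0‖) ^ 2)) (by fun_prop)) key

theorem iteratedDeriv_one_add_mul_mul {u : ℂ → ℂ} {x : ℂ} (c : ℂ) (n : ℕ)
    (hu : AnalyticAt ℂ u x) :
    iteratedDeriv (n + 1) (fun w ↦ (1 + c * w) * u w) x =
      (1 + c * x) * iteratedDeriv (n + 1) u x + (n + 1) * c * iteratedDeriv n u x := by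
  rw [iteratedDeriv_fun_mul (by fun_prop) hu.contDiffAt, Finset.sum_range_succ',
    Finset.sum_range_succ', Finset.sum_eq_zero]
  · simp
    ring
  · intro i _
    rw [iteratedDeriv_const_add (by omega), iteratedDeriv_const_mul_field]
    simp [iteratedDeriv_fun_id]

theorem iteratedDeriv_one_add_mul_pow_zero (c : ℂ) (m i : ℕ) :
    iteratedDeriv i (fun w ↦ (1 + c * w) ^ m) 0 = m.descFactorial i * c ^ i := by
  have h1 := congrFun (iteratedDeriv_comp_const_mul (n := i) (f := fun x : ℂ ↦ (1 + x) ^ m)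
    (by fun_prop) c) 0
  have h2 := congrFun (iteratedDeriv_comp_const_add i (fun x : ℂ ↦ x ^ m) 1) 0
  rw [h1, mul_zero, h2, iteratedDeriv_pow]
  simp [mul_comm]

theorem norm_add_div_one_add_conj_mul_lt_one {z w : ℂ} (hz : ‖z‖ < 1) (hw : ‖w‖ < 1) :
    ‖(z + w) / (1 + conj z * w)‖ < 1 := by
  rw [norm_div, div_lt_one (norm_pos_iff.2 (one_add_conj_mul_ne_zero hz hw))]
  refine (pow_lt_pow_iff_left₀ (norm_nonneg _) (norm_nonneg _) two_ne_zero).1 ?_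
  have h1 := norm_one_sub_conj_mul_sq_sub (-z) w
  have h2 : 0 < (1 - ‖z‖ ^ 2) * (1 - ‖w‖ ^ 2) :=
    mul_pos (by nlinarith [norm_nonneg z]) (by nlinarith [norm_nonneg w])
  simp only [map_neg, neg_mul, sub_neg_eq_add, norm_neg, add_comm w] at h1
  linarith

theorem hasDerivAt_add_div_one_add_mul {a c w : ℂ} (hw : 1 + c * w ≠ 0) :
    HasDerivAt (fun w ↦ (a + w) / (1 + c * w)) ((1 - c * a) / (1 + c * w) ^ 2) w := by
  have h1 : HasDerivAt (fun w ↦ a + w) 1 w := (hasDerivAt_id w).const_add a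
  have h2 : HasDerivAt (fun w ↦ 1 + c * w) c w := by
    simpa using ((hasDerivAt_id w).const_mul c).const_add 1
  convert! h1.div h2 hw using 1
  ring

/-- **Bol's lemma** for the disk automorphism `w ↦ (z + w) / (1 + conj z * w)`. -/
theorem iteratedDeriv_one_add_conj_mul_pow_mul_comp {f : ℂ → ℂ} {z : ℂ} (hz : ‖z‖ < 1)
    (hf : DifferentiableOn ℂ f (ball 0 1)) (m : ℕ) {w : ℂ} (hw : w ∈ ball (0 : ℂ) 1) :
    iteratedDeriv (m + 1)
        (fun w ↦ (1 + conj z * w) ^ m * f ((z + w) / (1 + conj z * w))) w =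
      (1 - conj z * z) ^ (m + 1) * iteratedDeriv (m + 1) f ((z + w) / (1 + conj z * w)) /
        (1 + conj z * w) ^ (m + 2) := by
  have hφ {w : ℂ} (hw : w ∈ ball (0 : ℂ) 1) : (z + w) / (1 + conj z * w) ∈ ball (0 : ℂ) 1 := by
    simpa using norm_add_div_one_add_conj_mul_lt_one hz (by simpa using hw)
  have hne {w : ℂ} (hw : w ∈ ball (0 : ℂ) 1) : 1 + conj z * w ≠ 0 :=
    one_add_conj_mul_ne_zero hz (by simpa using hw)
  have hfd (n : ℕ) {x : ℂ} (hx : x ∈ ball (0 : ℂ) 1) :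
      HasDerivAt (iteratedDeriv n f) (iteratedDeriv (n + 1) f x) x := by
    rw [iteratedDeriv_succ]
    have h := hf.analyticAt (isOpen_ball.mem_nhds hx)
    rw [iteratedDeriv_eq_iterate]
    exact (h.iterated_deriv n).differentiableAt.hasDerivAt
  induction m generalizing w with
  | zero =>
    have h1 := (hfd 0 (hφ hw)).comp w (hasDerivAt_add_div_one_add_mul (hne hw))
    simp only [iteratedDeriv_zero] at h1
    simp only [pow_zero, one_mul, zero_add, iteratedDeriv_one] at h1 ⊢
    refine h1.deriv.trans ?_
    ring
  | succ m ih =>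
    set u : ℂ → ℂ := fun w ↦ (1 + conj z * w) ^ m * f ((z + w) / (1 + conj z * w)) with hu
    have hud : DifferentiableOn ℂ u (ball 0 1) := by
      refine DifferentiableOn.mul (by fun_prop) fun x hx ↦ ?_
      have h0 := (hfd 0 (hφ hx)).comp x (hasDerivAt_add_div_one_add_mul (hne hx))
      exact (iteratedDeriv_zero (f := f) ▸ h0).differentiableAt.differentiableWithinAt
    have hnear := isOpen_ball.mem_nhds hw
    have hstep : iteratedDeriv (m + 2) u w =
        (1 - conj z * z) ^ (m + 2) * iteratedDeriv (m + 2) f ((z + w) / (1 + conj z * w)) /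
          (1 + conj z * w) ^ (m + 4) - (m + 2) * conj z * ((1 - conj z * z) ^ (m + 1) *
            iteratedDeriv (m + 1) f ((z + w) / (1 + conj z * w)) /
              (1 + conj z * w) ^ (m + 3)) := by
      have hev : iteratedDeriv (m + 1) u =ᶠ[𝓝 w] _ := eventually_of_mem hnear fun x hx ↦ ih hx
      rw [iteratedDeriv_succ, hev.deriv_eq]
      have h1 := (hfd (m + 1) (hφ hw)).comp w (hasDerivAt_add_div_one_add_mul (hne hw))
      have h2 : HasDerivAt (fun w ↦ 1 + conj z * w) (conj z) w := by
        simpa using ((hasDerivAt_id w).const_mul (conj z)).const_add 1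
      have h3 := ((h1.const_mul ((1 - conj z * z) ^ (m + 1))).div (h2.fun_pow (m + 2))
        (pow_ne_zero _ (hne hw))).deriv
      refine h3.trans ?_
      have := hne hw
      simp only [Function.comp_apply, show m + 2 - 1 = m + 1 by omega]
      push_cast
      field_simp
      ring
    have hfun : (fun w ↦ (1 + conj z * w) ^ (m + 1) * f ((z + w) / (1 + conj z * w))) =
        fun w ↦ (1 + conj z * w) * u w := by
      funext x
      rw [hu]
      ring
    rw [hfun, iteratedDeriv_one_add_mul_mul _ _ (hud.analyticAt hnear), hstep, ih hw]
    have := hne hw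
    push_cast
    field_simp
    ring

theorem stmt_13 (f : ℂ → ℂ)
    (hf : DifferentiableOn ℂ f (Metric.ball (0 : ℂ) 1))
    (hb : ∀ z : ℂ, ‖z‖ < 1 → ‖f z‖ ≤ 1) :
    ∀ k : ℕ, 1 ≤ k → ∀ z : ℂ, ‖z‖ < 1 →
      ‖iteratedDeriv k f z‖
        ≤ (Nat.factorial k : ℝ) * (1 - ‖f z‖ ^ 2) * (1 + ‖z‖) ^ (k - 1)
            / (1 - ‖z‖ ^ 2) ^ k := by
  intro k hk z hz
  obtain ⟨m, rfl⟩ : ∃ m, k = m + 1 := ⟨k - 1, by omega⟩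
  have h00 : (0 : ℂ) ∈ ball (0 : ℂ) 1 := by simp
  set g : ℂ → ℂ := fun w ↦ f ((z + w) / (1 + conj z * w)) with hg
  have hg0 : g 0 = f z := by simp [hg]
  have hgb : ∀ w ∈ ball (0 : ℂ) 1, ‖g w‖ ≤ 1 := fun w hw ↦
    hb _ (norm_add_div_one_add_conj_mul_lt_one hz (by simpa using hw))
  have hgd : DifferentiableOn ℂ g (ball 0 1) := by
    refine hf.comp (fun w hw ↦ ?_) fun w hw ↦ ?_
    · exact (hasDerivAt_add_div_one_add_mul (one_add_conj_mul_ne_zero hz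
        (by simpa using hw))).differentiableAt.differentiableWithinAt
    · simpa using norm_add_div_one_add_conj_mul_lt_one hz (by simpa using hw)
  have hρ : 0 < 1 - ‖z‖ ^ 2 := by nlinarith [norm_nonneg z]
  have hρn : ‖1 - conj z * z‖ = 1 - ‖z‖ ^ 2 := norm_one_sub_conj_mul_self hz.le
  have hbol := iteratedDeriv_one_add_conj_mul_pow_mul_comp hz hf m h00
  simp only [mul_zero, add_zero, one_pow, div_one] at hbol
  have hleib := iteratedDeriv_fun_mul (n := m + 1) (x := (0 : ℂ))
    (f := fun w ↦ (1 + conj z * w) ^ m) (g := g) (by fun_prop)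
    (hgd.analyticAt (isOpen_ball.mem_nhds h00)).contDiffAt
  rw [hbol, Finset.sum_range_succ, iteratedDeriv_one_add_mul_pow_zero,
    Nat.descFactorial_of_lt (Nat.lt_succ_self m)] at hleib
  simp only [iteratedDeriv_one_add_mul_pow_zero, Nat.cast_zero, zero_mul, mul_zero,
    add_zero] at hleib
  rw [le_div_iff₀ (pow_pos hρ _), Nat.add_sub_cancel, mul_comm, ← hρn, ← norm_pow, ← norm_mul,
    hleib, add_comm 1 ‖z‖, add_pow, Finset.mul_sum]
  refine norm_sum_le_of_le _ fun i hi ↦ ?_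
  have him : i ≤ m := Nat.lt_succ_iff.1 (Finset.mem_range.1 hi)
  have hc := norm_iteratedDeriv_zero_le_of_norm_le_one (n := m + 1 - i) (by omega) hgd hgb
  rw [hg0] at hc
  have hfac : ((m + 1).choose i : ℝ) * m.descFactorial i * (m + 1 - i).factorial =
      (m + 1).factorial * m.choose i := by
    rw [Nat.descFactorial_eq_factorial_mul_choose,
      ← Nat.choose_mul_factorial_mul_factorial (show i ≤ m + 1 by omega)]
    push_cast
    ring
  simp only [norm_mul, norm_pow, Complex.norm_natCast, Complex.norm_conj, one_pow, mul_one]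
  calc _ ≤ ((m + 1).choose i : ℝ) * (m.descFactorial i * ‖z‖ ^ i) *
        ((m + 1 - i).factorial * (1 - ‖f z‖ ^ 2)) := by gcongr
    _ = ((m + 1).choose i * m.descFactorial i * (m + 1 - i).factorial) *
        (1 - ‖f z‖ ^ 2) * ‖z‖ ^ i := by ring
    _ = _ := by rw [hfac]; ring
end

section
/- Let f(z) = Σ_{n=0}^∞ a_n z^n belong to the class B. Then for every r with 0 < r ≤ 1/√2: Σ_{n=1}^∞ n |a_n|² r^{2n} ≤ r² (1 − |a₀|²)² / (1 − |a₀|² r²)². (Equivalently, S_r/π ≤ r² (1 − |a₀|²)²/(1 − |a₀|² r²)², where S_r = ∫_{|z|<r} |f′(z)|² dA(z).) -/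
open MeasureTheory Finset in
/-- The Fourier coefficients of the sum of a uniformly convergent shifted power series. -/
theorem inner_fourierLp_of_hasSum {b : ℕ → ℂ} {n : ℕ} {G : C(UnitAddCircle, ℂ)}
    (hG : HasSum (fun k : ℕ => b k • fourier (T := 1) ((k : ℤ) + n)) G) (m : ℕ) :
    inner ℂ (fourierLp (T := 1) 2 m) (ContinuousMap.toLp 2 AddCircle.haarAddCircle ℂ G)
      = if n ≤ m then b (m - n) else 0 := by
  have h := (innerSL ℂ (fourierLp (T := 1) 2 m)).hasSum
    ((ContinuousMap.toLp (E := ℂ) 2 (AddCircle.haarAddCircle (T := 1)) ℂ).hasSum hG)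
  have ho := orthonormal_iff_ite.mp (orthonormal_fourier (T := 1)) m
  refine HasSum.unique h ?_
  simp only [map_smul, innerSL_apply_apply, smul_eq_mul, ho, mul_ite, mul_one, mul_zero]
  split_ifs with hnm
  · convert hasSum_single (m - n) ?_ using 1
    · simp [Nat.cast_sub hnm]
    · intro k hk
      rw [if_neg]
      omega
  · convert hasSum_zero using 2 with k
    rw [if_neg]
    omega

open MeasureTheory Finset in
/-- Multiplication by a function of class `B` contracts the `L²` norm of `1 - d zⁿ` on the circle of
radius `ρ`. -/
theorem InClassB.sum_add_norm_sub_sq_le_of_lt_one {f : ℂ → ℂ} {a : ℕ → ℂ} (hf : InClassB f a)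
    {ρ : ℝ} (h0 : 0 ≤ ρ) (h1 : ρ < 1) (n : ℕ) (d : ℂ) :
    ∑ k ∈ range (n + 1), ‖a k * ρ ^ k‖ ^ 2 + ‖a (n + 1) * ρ ^ (n + 1) - d * a 0‖ ^ 2
      ≤ 1 + ‖d‖ ^ 2 := by
  have hsum : Summable fun k => ‖a k * (ρ : ℂ) ^ k‖ := by
    obtain ⟨σ, hρσ, hσ1⟩ := exists_between h1
    have hσ0 : 0 ≤ σ := h0.trans hρσ.le
    have hs := (hf.1 σ (by simpa [abs_of_nonneg hσ0] using hσ1)).summable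
    have hb := hs.tendsto_atTop_zero.norm.bddAbove_range
    obtain ⟨C, hC⟩ := hb
    have hσ : 0 < σ := h0.trans_lt hρσ
    refine Summable.of_nonneg_of_le (fun _ => norm_nonneg _) (fun k => ?_)
      ((summable_geometric_of_lt_one (div_nonneg h0 hσ0)
        ((div_lt_one hσ).2 hρσ)).mul_left C)
    have hk : ‖a k * (σ : ℂ) ^ k‖ ≤ C := hC ⟨k, rfl⟩
    calc ‖a k * (ρ : ℂ) ^ k‖ = ‖a k * (σ : ℂ) ^ k‖ * (ρ / σ) ^ k := by
          simp only [norm_mul, norm_pow, Complex.norm_real, Real.norm_eq_abs, abs_of_nonneg h0,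
            abs_of_nonneg hσ0, div_pow]
          field_simp
      _ ≤ C * (ρ / σ) ^ k := by gcongr
  have hsumC : Summable fun k : ℕ => (a k * (ρ : ℂ) ^ k) • fourier (T := 1) (k : ℤ) := by
    refine Summable.of_norm ?_
    simpa only [norm_smul, fourier_norm, mul_one] using hsum
  obtain ⟨G, hG⟩ := hsumC
  have hG0 : HasSum (fun k : ℕ => (a k * (ρ : ℂ) ^ k) • fourier (T := 1) ((k : ℤ) + (0 : ℕ))) G := by
    simpa using hG
  have hG1 : HasSum (fun k : ℕ => (a k * (ρ : ℂ) ^ k) • fourier (T := 1) ((k : ℤ) + (n + 1 : ℕ)))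
      (G * fourier ((n + 1 : ℕ) : ℤ)) := by
    have h (k : ℕ) : fourier (T := 1) ((k : ℤ) + (n + 1 : ℕ))
        = fourier (k : ℤ) * fourier ((n + 1 : ℕ) : ℤ) := ContinuousMap.ext fun x => fourier_add
    simpa only [h, smul_mul_assoc] using hG.mul_right (fourier (T := 1) ((n + 1 : ℕ) : ℤ))
  have hGle (x : UnitAddCircle) : ‖G x‖ ≤ 1 := by
    have hz : ‖(ρ : ℂ) * fourier 1 x‖ < 1 := by
      rw [fourier_apply, norm_mul, Circle.norm_coe]
      simpa [abs_of_nonneg h0] using h1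
    have he := (ContinuousMap.evalCLM ℂ x).hasSum hG
    have : G x = f (ρ * fourier 1 x) := by
      refine he.unique ?_
      convert hf.1 _ hz using 2 with k
      simp [fourier_apply, AddCircle.toCircle_nsmul, mul_pow, mul_assoc]
    rw [this]
    exact hf.2 _ hz
  set L := ContinuousMap.toLp (E := ℂ) 2 (AddCircle.haarAddCircle (T := 1)) ℂ
  have hle : ‖L (G - d • (G * fourier ((n + 1 : ℕ) : ℤ)))‖
      ≤ ‖L (fourier 0 - d • fourier ((n + 1 : ℕ) : ℤ))‖ := by
    refine Lp.norm_le_norm_of_ae_le ?_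
    filter_upwards [ContinuousMap.coeFn_toLp (p := 2) (𝕜 := ℂ) (AddCircle.haarAddCircle (T := 1))
        (G - d • (G * fourier ((n + 1 : ℕ) : ℤ))),
      ContinuousMap.coeFn_toLp (p := 2) (𝕜 := ℂ) (AddCircle.haarAddCircle (T := 1))
        (fourier 0 - d • fourier ((n + 1 : ℕ) : ℤ))] with x hx hy
    rw [hx, hy]
    have : (G - d • (G * fourier ((n + 1 : ℕ) : ℤ)) : C(UnitAddCircle, ℂ)) x
        = G x * ((fourier 0 - d • fourier ((n + 1 : ℕ) : ℤ) : C(UnitAddCircle, ℂ)) x) := by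
      simp only [ContinuousMap.sub_apply, ContinuousMap.smul_apply, ContinuousMap.mul_apply,
        fourier_zero, smul_eq_mul]
      ring
    rw [this, norm_mul]
    exact mul_le_of_le_one_left (norm_nonneg _) (hGle x)
  have hO := orthonormal_fourier (T := 1)
  have hp : ‖L (fourier 0 - d • fourier ((n + 1 : ℕ) : ℤ))‖ ^ 2 = 1 + ‖d‖ ^ 2 := by
    have h0 : ‖L (fourier 0)‖ = 1 := hO.1 0
    have hn : ‖L (fourier ((n + 1 : ℕ) : ℤ))‖ = 1 := hO.1 _
    have hi : inner ℂ (L (fourier 0)) (L (fourier ((n + 1 : ℕ) : ℤ))) = 0 := hO.2 (by omega)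
    rw [map_sub, map_smul, @norm_sub_sq ℂ, inner_smul_right, hi, norm_smul, h0, hn]
    simp
  have hB := (hO.comp _ Nat.cast_injective).sum_inner_products_le
    (L (G - d • (G * fourier ((n + 1 : ℕ) : ℤ)))) (s := range (n + 2))
  rw [sum_range_succ] at hB
  refine le_trans (le_of_eq ?_) (hB.trans ((pow_le_pow_left₀ (norm_nonneg _) hle 2).trans_eq hp))
  have hin (m : ℕ) := inner_fourierLp_of_hasSum hG0 m
  have hin' (m : ℕ) := inner_fourierLp_of_hasSum hG1 m
  simp only [Function.comp_apply, map_sub, map_smul, inner_sub_right, inner_smul_right]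
  congr 1
  · refine sum_congr rfl fun k hk => ?_
    rw [mem_range] at hk
    rw [hin, hin', if_pos k.zero_le, if_neg (by omega)]
    simp
  · rw [hin, hin']
    simp

open Finset in
theorem InClassB.sum_add_norm_sub_sq_le {f : ℂ → ℂ} {a : ℕ → ℂ} (hf : InClassB f a)
    (n : ℕ) (c : ℂ) :
    ∑ k ∈ range (n + 1), ‖a k‖ ^ 2 + ‖a (n + 1) - c * a 0‖ ^ 2 ≤ 1 + ‖c‖ ^ 2 := by
  have hcont : Continuous fun ρ : ℝ => ∑ k ∈ range (n + 1), ‖a k * (ρ : ℂ) ^ k‖ ^ 2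
      + ‖a (n + 1) * (ρ : ℂ) ^ (n + 1) - c * a 0‖ ^ 2 := by fun_prop
  have ht := (hcont.tendsto 1).mono_left (nhdsWithin_le_nhds (s := Set.Iio 1))
  have hle := le_of_tendsto ht (b := 1 + ‖c‖ ^ 2) (by
    filter_upwards [Ioo_mem_nhdsLT (show (0 : ℝ) < 1 by norm_num)] with ρ hρ
    exact hf.sum_add_norm_sub_sq_le_of_lt_one hρ.1.le hρ.2 n c)
  simpa using hle

open Finset in
theorem InClassB.sum_norm_sq_succ_le {f : ℂ → ℂ} {a : ℕ → ℂ} (hf : InClassB f a) (n : ℕ) :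
    ∑ k ∈ range (n + 1), ‖a (k + 1)‖ ^ 2
      ≤ ‖a 0‖ ^ 2 * ∑ k ∈ range n, ‖a (k + 1)‖ ^ 2 + (1 - ‖a 0‖ ^ 2) ^ 2 := by
  have h1 := hf.sum_add_norm_sub_sq_le n 0
  rw [sum_range_succ'] at h1
  simp only [zero_mul, sub_zero, norm_zero] at h1
  rw [sum_range_succ]
  set A := ∑ k ∈ range n, ‖a (k + 1)‖ ^ 2 with hA
  have hA0 : 0 ≤ A := sum_nonneg fun _ _ => sq_nonneg _
  set t := 1 - ‖a 0‖ ^ 2 with ht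
  have hn0 := sq_nonneg ‖a (n + 1)‖
  have ht0 : 0 ≤ t := by linarith
  rcases ht0.eq_or_lt with h | h
  · have : ‖a 0‖ ^ 2 = 1 := by linarith
    rw [this, ← h]
    linarith
  · have h2 := hf.sum_add_norm_sub_sq_le n (-(a (n + 1) * (starRingEnd ℂ) (a 0) / (t : ℂ)))
    have hc : a (n + 1) - -(a (n + 1) * (starRingEnd ℂ) (a 0) / (t : ℂ)) * a 0
        = a (n + 1) / (t : ℂ) := by
      have ht' : (t : ℂ) ≠ 0 := by exact_mod_cast h.ne'
      have hq : (starRingEnd ℂ) (a 0) * a 0 = 1 - (t : ℂ) := by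
        rw [Complex.conj_mul', ht]
        push_cast
        ring
      field_simp
      linear_combination (a (n + 1)) * hq
    rw [sum_range_succ', hc, norm_neg, norm_div, norm_div, norm_mul, RCLike.norm_conj,
      Complex.norm_real, Real.norm_of_nonneg ht0, div_pow, div_pow, mul_pow] at h2
    have hq : ‖a 0‖ ^ 2 = 1 - t := by rw [ht]; ring
    simp only [← hA, hq] at h2 ⊢
    have h3 : ‖a (n + 1)‖ ^ 2 / t ≤ t - A := by
      have : ‖a (n + 1)‖ ^ 2 / t ^ 2 - ‖a (n + 1)‖ ^ 2 * (1 - t) / t ^ 2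
          = ‖a (n + 1)‖ ^ 2 / t := by
        field_simp
        ring
      linarith
    rw [div_le_iff₀ h] at h3
    linarith

open Finset in
/-- Rogosinski's inequality for the subordination of `f` to a disk automorphism. -/
theorem InClassB.sum_norm_sq_le_geom {f : ℂ → ℂ} {a : ℕ → ℂ} (hf : InClassB f a) (n : ℕ) :
    ∑ k ∈ range n, ‖a (k + 1)‖ ^ 2
      ≤ ∑ k ∈ range n, (1 - ‖a 0‖ ^ 2) ^ 2 * (‖a 0‖ ^ 2) ^ k := by
  induction n with
  | zero => simp
  | succ n ih =>
    refine (hf.sum_norm_sq_succ_le n).trans ?_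
    rw [sum_range_succ', pow_zero, mul_one]
    have h : ∑ k ∈ range n, (1 - ‖a 0‖ ^ 2) ^ 2 * (‖a 0‖ ^ 2) ^ (k + 1)
        = ‖a 0‖ ^ 2 * ∑ k ∈ range n, (1 - ‖a 0‖ ^ 2) ^ 2 * (‖a 0‖ ^ 2) ^ k := by
      rw [mul_sum]
      exact sum_congr rfl fun k _ => by ring
    rw [h]
    gcongr

open Finset in
/-- Abel summation: antitone nonnegative weights preserve domination of partial sums. -/
theorem sum_range_mul_le_of_antitone {w x y : ℕ → ℝ} (hw : Antitone w) (hw0 : ∀ n, 0 ≤ w n)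
    (h : ∀ n, ∑ k ∈ range n, x k ≤ ∑ k ∈ range n, y k) (n : ℕ) :
    ∑ k ∈ range n, w k * x k ≤ ∑ k ∈ range n, w k * y k := by
  suffices H : w n * (∑ k ∈ range n, y k - ∑ k ∈ range n, x k)
      ≤ ∑ k ∈ range n, w k * y k - ∑ k ∈ range n, w k * x k by
    linarith [mul_nonneg (hw0 n) (sub_nonneg.2 (h n))]
  induction n with
  | zero => simp
  | succ n ih =>
    refine (mul_le_mul_of_nonneg_right (hw n.le_succ) (sub_nonneg.2 (h (n + 1)))).trans ?_
    simp only [sum_range_succ]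
    linarith

theorem stmt_14 (f : ℂ → ℂ) (a : ℕ → ℂ) (hf : InClassB f a)
    (r : ℝ) (hr0 : 0 < r) (hr1 : r ≤ 1 / Real.sqrt 2) :
    ∑' n : ℕ, ((n : ℝ) + 1) * ‖a (n + 1)‖ ^ 2 * r ^ (2 * (n + 1))
      ≤ r ^ 2 * (1 - ‖a 0‖ ^ 2) ^ 2 / (1 - ‖a 0‖ ^ 2 * r ^ 2) ^ 2 := by
  have hr2 : r ^ 2 ≤ 1 / 2 := by
    calc r ^ 2 ≤ (1 / Real.sqrt 2) ^ 2 := by gcongr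
      _ = 1 / 2 := by simp
  have hw : Antitone fun n : ℕ => ((n : ℝ) + 1) * r ^ (2 * (n + 1)) := by
    refine antitone_nat_of_succ_le fun n => ?_
    have hn : (0 : ℝ) ≤ n := n.cast_nonneg
    have hs : ((n : ℝ) + 1 + 1) * r ^ 2 ≤ n + 1 := by nlinarith
    calc (((n + 1 : ℕ) : ℝ) + 1) * r ^ (2 * (n + 1 + 1))
        = ((n : ℝ) + 1 + 1) * r ^ 2 * r ^ (2 * (n + 1)) := by push_cast; ring
      _ ≤ (n + 1) * r ^ (2 * (n + 1)) := by gcongr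
  have ha : ‖a 0‖ ^ 2 ≤ 1 := by
    have h := hf.2 0 (by simp)
    rw [(hf.1 0 (by simp)).unique (hasSum_single 0 fun k hk => by simp [hk])] at h
    exact pow_le_one₀ (norm_nonneg _) (by simpa using h)
  have hq : ‖‖a 0‖ ^ 2 * r ^ 2‖ < 1 := by
    rw [Real.norm_of_nonneg (by positivity)]
    nlinarith [sq_nonneg r]
  have hS := (hasSum_choose_mul_geometric_of_norm_lt_one 1 hq).mul_left
    (r ^ 2 * (1 - ‖a 0‖ ^ 2) ^ 2)
  rw [mul_one_div] at hS
  refine Real.tsum_le_of_sum_range_le (fun n => by positivity) fun N => ?_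
  calc ∑ n ∈ Finset.range N, ((n : ℝ) + 1) * ‖a (n + 1)‖ ^ 2 * r ^ (2 * (n + 1))
      = ∑ n ∈ Finset.range N, ((n : ℝ) + 1) * r ^ (2 * (n + 1)) * ‖a (n + 1)‖ ^ 2 :=
        Finset.sum_congr rfl fun n _ => by ring
    _ ≤ ∑ n ∈ Finset.range N, ((n : ℝ) + 1) * r ^ (2 * (n + 1))
          * ((1 - ‖a 0‖ ^ 2) ^ 2 * (‖a 0‖ ^ 2) ^ n) :=
        sum_range_mul_le_of_antitone hw (fun n => by positivity) hf.sum_norm_sq_le_geom N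
    _ = ∑ n ∈ Finset.range N, r ^ 2 * (1 - ‖a 0‖ ^ 2) ^ 2
          * (((n + 1).choose 1 : ℕ) * (‖a 0‖ ^ 2 * r ^ 2) ^ n) :=
        Finset.sum_congr rfl fun n _ => by
          rw [Nat.choose_one_right]
          push_cast
          ring
    _ ≤ _ := sum_le_hasSum _ (fun n _ => by positivity) hS
end
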